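/- Let G be a finite group in which all maximal chains in G of every subgroup of prime order have the same length, and let F(G) denote the Fitting subgroup of G. Then G is non-supersolvable if and only if all of the following hold: Φ(G) = 1, Z(G) = 1, F(G) is the unique minimal normal subgroup of G, |F(G)| = p^n for some prime p and some n ≥ 2, there is a maximal subgroup M of G that is supersolvable with F(G) ∩ M = 1 and F(G)M = G (so G = F(G) ⋊ M), and M acts faithfully on F(G) by conjugation (equivalently C_G(F(G)) = F(G)). -/

import Mathlib

/-- A maximal chain of `H` in the ambient group of length `r`: a chain
`H = c 0 < c 1 < ... < c r = ⊤` where each `c i` is a maximal subgroup of `c (i+1)`,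
i.e. each step is a covering relation in the subgroup lattice. -/
def IsMaxChainOf {G : Type*} [Group G] (H : Subgroup G) (r : ℕ) (c : ℕ → Subgroup G) : Prop :=
  c 0 = H ∧ c r = ⊤ ∧ ∀ i < r, c i ⋖ c (i + 1)

/-- All maximal chains of `H` in the ambient group have the same length. -/
def AllMaxChainsSameLength {G : Type*} [Group G] (H : Subgroup G) : Prop :=
  ∀ (r s : ℕ) (c d : ℕ → Subgroup G),
    IsMaxChainOf H r c → IsMaxChainOf H s d → r = s


/-- A group is supersolvable if it has a normal series (all terms normal in the whole
group) with cyclic factors.  The factor `s (i+1) / s i` being cyclic is encoded as: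
some single element `g` together with `s i` generates `s (i+1)`. -/
def IsSupersolvable (G : Type*) [Group G] : Prop :=
  ∃ (n : ℕ) (s : ℕ → Subgroup G), s 0 = ⊥ ∧ s n = ⊤ ∧ (∀ i, (s i).Normal) ∧
    ∀ i < n, ∃ g : G, s i ⊔ Subgroup.zpowers g = s (i + 1)

open scoped ArithmeticFunction.Omega

/-- `CoverChain a b n`: there is a chain of `n` covering relations from `a` to `b`. -/
inductive CoverChain {α : Type*} [Preorder α] : α → α → ℕ → Prop
  | refl (a : α) : CoverChain a a 0
  | cons {a b c : α} {n : ℕ} : a ⋖ b → CoverChain b c n → CoverChain a c (n + 1)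

namespace CoverChain

variable {α β : Type*}

theorem trans [Preorder α] {a b c : α} {m n : ℕ} (h : CoverChain a b m) (h' : CoverChain b c n) :
    CoverChain a c (m + n) := by
  induction h with
  | refl => simpa using h'
  | cons hab _ ih =>
    rw [Nat.add_right_comm]
    exact .cons hab (ih h')

theorem single [Preorder α] {a b : α} (h : a ⋖ b) : CoverChain a b 1 :=
  .cons h (.refl b)

theorem map [Preorder α] [Preorder β] {f : α → β} (hf : ∀ x y, x ⋖ y → f x ⋖ f y) {a b : α}
    {n : ℕ} (h : CoverChain a b n) : CoverChain (f a) (f b) n := by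
  induction h with
  | refl => exact .refl _
  | cons hab _ ih => exact .cons (hf _ _ hab) ih

theorem exists_sequence [Preorder α] {a b : α} {n : ℕ} (h : CoverChain a b n) :
    ∃ c : ℕ → α, c 0 = a ∧ c n = b ∧ ∀ i < n, c i ⋖ c (i + 1) := by
  induction h with
  | refl a => exact ⟨fun _ => a, rfl, rfl, by simp⟩
  | @cons a b c n hab _ ih =>
    obtain ⟨d, hd0, hdn, hd⟩ := ih
    refine ⟨fun i => Nat.casesOn i a d, rfl, hdn, ?_⟩
    rintro (_ | i) hi
    · simpa [hd0] using hab
    · exact hd i (by omega)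

end CoverChain

namespace Subgroup

variable {G : Type*} [Group G]

theorem covBy_of_relIndex_prime {H K : Subgroup G} (hHK : H ≤ K)
    (h : (H.relIndex K).Prime) : H ⋖ K := by
  refine ⟨lt_of_le_of_ne hHK fun h' => ?_, fun X hHX hXK => ?_⟩
  · rw [h', relIndex_self] at h
    exact Nat.not_prime_one h
  · rw [← relIndex_mul_relIndex _ _ _ hHX.le hXK.le, Nat.prime_mul_iff] at h
    simp only [relIndex_eq_one] at h
    rcases h with ⟨-, h⟩ | ⟨-, h⟩
    · exact hXK.not_ge h
    · exact hHX.not_ge h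

theorem relIndex_ne_zero_of_finite [Finite G] (H K : Subgroup G) : H.relIndex K ≠ 0 :=
  index_ne_zero_of_finite

theorem exists_coverChain_le [Finite G] (H K : Subgroup G) (hHK : H ≤ K) :
    ∃ n ≤ Ω (H.relIndex K), CoverChain H K n := by
  induction H using WellFoundedGT.induction with
  | ind H ih =>
    rcases hHK.eq_or_lt with rfl | hlt
    · exact ⟨0, by simp, .refl _⟩
    · obtain ⟨X, hHX, hXK⟩ := exists_covBy_le_of_lt hlt
      obtain ⟨n, hn, hc⟩ := ih X hHX.lt hXK
      refine ⟨n + 1, ?_, .cons hHX hc⟩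
      have h1 : H.relIndex X ≠ 1 := fun h => hHX.lt.not_ge (relIndex_eq_one.1 h)
      have h0 : H.relIndex X ≠ 0 := relIndex_ne_zero_of_finite H X
      rw [← relIndex_mul_relIndex _ _ _ hHX.le hXK,
        ArithmeticFunction.cardFactors_mul h0 (relIndex_ne_zero_of_finite X K)]
      have : Ω (H.relIndex X) ≠ 0 := by
        simp [ArithmeticFunction.cardFactors_eq_zero_iff_eq_zero_or_one, h0, h1]
      omega

theorem map_covBy_map_of_injective {G' : Type*} [Group G'] {f : G →* G'}
    (hf : Function.Injective f) {H K : Subgroup G} (h : H ⋖ K) : H.map f ⋖ K.map f := by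
  refine ⟨(map_lt_map_iff_of_injective hf).2 h.lt, fun X hHX hXK => ?_⟩
  have hX : (X.comap f).map f = X :=
    map_comap_eq_self (hXK.le.trans (map_le_range f K))
  rw [← hX, map_lt_map_iff_of_injective hf] at hHX hXK
  exact h.2 hHX hXK

theorem comap_covBy_comap_of_surjective {G' : Type*} [Group G'] {f : G →* G'}
    (hf : Function.Surjective f) {H K : Subgroup G'} (h : H ⋖ K) : H.comap f ⋖ K.comap f := by
  refine ⟨(comap_lt_comap_of_surjective hf).2 h.lt, fun X hHX hXK => ?_⟩
  have hX : (X.map f).comap f = X :=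
    comap_map_eq_self ((ker_le_comap f H).trans hHX.le)
  rw [← hX, comap_lt_comap_of_surjective hf] at hHX hXK
  exact h.2 hHX hXK

end Subgroup

/-- Chains of covers from any subgroup of prime order to the whole group have the same length. -/
def HasEqualAtomChains (G : Type*) [Group G] : Prop :=
  ∀ (H : Subgroup G) (r s : ℕ), (Nat.card H).Prime →
    CoverChain H ⊤ r → CoverChain H ⊤ s → r = s

theorem CoverChain.exists_isMaxChainOf {G : Type*} [Group G] {H : Subgroup G} {r : ℕ}
    (h : CoverChain H ⊤ r) : ∃ c, IsMaxChainOf H r c :=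
  h.exists_sequence

theorem HasEqualAtomChains.of_forall {G : Type*} [Group G]
    (h : ∀ H : Subgroup G, (Nat.card H).Prime → AllMaxChainsSameLength H) :
    HasEqualAtomChains G := fun H r s hH hr hs => by
  obtain ⟨c, hc⟩ := hr.exists_isMaxChainOf
  obtain ⟨d, hd⟩ := hs.exists_isMaxChainOf
  exact h H hH r s c d hc hd

section Transport

variable {G : Type*} [Group G]

theorem CoverChain.map_subtype {Y : Subgroup G} {H K : Subgroup Y} {n : ℕ}
    (h : CoverChain H K n) : CoverChain (H.map Y.subtype) (K.map Y.subtype) n :=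
  h.map fun _ _ => Subgroup.map_covBy_map_of_injective Y.subtype_injective

theorem CoverChain.map_subtype_top {Y : Subgroup G} {H : Subgroup Y} {n : ℕ}
    (h : CoverChain H ⊤ n) : CoverChain (H.map Y.subtype) Y n := by
  simpa [← MonoidHom.range_eq_map] using h.map_subtype

theorem CoverChain.comap_mk {N : Subgroup G} [N.Normal] {H K : Subgroup (G ⧸ N)} {n : ℕ}
    (h : CoverChain H K n) :
    CoverChain (H.comap (QuotientGroup.mk' N)) (K.comap (QuotientGroup.mk' N)) n :=
  h.map fun _ _ => Subgroup.comap_covBy_comap_of_surjective (QuotientGroup.mk'_surjective N)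

theorem HasEqualAtomChains.subgroup [Finite G] (h : HasEqualAtomChains G) (Y : Subgroup G) :
    HasEqualAtomChains Y := fun H r s hH hr hs => by
  obtain ⟨n, -, hn⟩ := Subgroup.exists_coverChain_le Y ⊤ le_top
  have := h (H.map Y.subtype) _ _
    (by rwa [Subgroup.card_map_of_injective Y.subtype_injective])
    (hr.map_subtype_top.trans hn) (hs.map_subtype_top.trans hn)
  omega

theorem Subgroup.exists_le_card_prime [Finite G] {N : Subgroup G} (hN : N ≠ ⊥) :
    ∃ H ≤ N, (Nat.card H).Prime := by
  have h1 : Nat.card N ≠ 1 := by rwa [Ne, Subgroup.card_eq_one]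
  have : Fact (Nat.card N).minFac.Prime := ⟨Nat.minFac_prime h1⟩
  obtain ⟨x, hx⟩ := exists_prime_orderOf_dvd_card' _ (Nat.minFac_dvd (Nat.card N))
  refine ⟨zpowers (x : G), by simp, ?_⟩
  rw [Nat.card_zpowers, Subgroup.orderOf_coe, hx]
  exact this.out

theorem HasEqualAtomChains.quotient_bot [Finite G] (h : HasEqualAtomChains G) (N : Subgroup G)
    [N.Normal] (hN : N ≠ ⊥) {r s : ℕ} (hr : CoverChain (⊥ : Subgroup (G ⧸ N)) ⊤ r)
    (hs : CoverChain (⊥ : Subgroup (G ⧸ N)) ⊤ s) : r = s := by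
  obtain ⟨H, hHN, hH⟩ := Subgroup.exists_le_card_prime hN
  obtain ⟨n, -, hn⟩ := Subgroup.exists_coverChain_le H N hHN
  have hr' := hr.comap_mk
  have hs' := hs.comap_mk
  rw [MonoidHom.comap_bot, QuotientGroup.ker_mk', Subgroup.comap_top] at hr' hs'
  have := h H _ _ hH (hn.trans hr') (hn.trans hs')
  omega

theorem Subgroup.bot_covBy_of_card_prime {H : Subgroup G} (hH : (Nat.card H).Prime) : ⊥ ⋖ H :=
  covBy_of_relIndex_prime bot_le (by rwa [relIndex_bot_left])

theorem HasEqualAtomChains.quotient [Finite G] (h : HasEqualAtomChains G) (N : Subgroup G)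
    [N.Normal] (hN : N ≠ ⊥) : HasEqualAtomChains (G ⧸ N) := fun H r s hH hr hs => by
  have h1 := Subgroup.bot_covBy_of_card_prime hH
  have := h.quotient_bot N hN (.cons h1 hr) (.cons h1 hs)
  omega

end Transport

section Supersolvable

open Subgroup

variable {G : Type*} [Group G]

/-- One step of a normal series with cyclic factors. -/
def CyclicStep (A B : Subgroup G) : Prop :=
  A.Normal ∧ B.Normal ∧ ∃ g : G, A ⊔ zpowers g = B

theorem isSupersolvable_iff :
    IsSupersolvable G ↔ Relation.ReflTransGen CyclicStep (⊥ : Subgroup G) ⊤ := by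
  constructor
  · rintro ⟨n, s, h0, hn, hs, hc⟩
    have : ∀ i ≤ n, Relation.ReflTransGen CyclicStep ⊥ (s i) := by
      intro i
      induction i with
      | zero => exact fun _ => h0 ▸ .refl
      | succ i ih => exact fun hi => (ih (by omega)).tail ⟨hs _, hs _, hc i (by omega)⟩
    exact hn ▸ this n le_rfl
  · intro h
    suffices ∀ A : Subgroup G, Relation.ReflTransGen CyclicStep ⊥ A →
        ∃ (n : ℕ) (s : ℕ → Subgroup G), s 0 = ⊥ ∧ (∀ i, n ≤ i → s i = A) ∧ (∀ i, (s i).Normal) ∧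
          ∀ i < n, ∃ g : G, s i ⊔ zpowers g = s (i + 1) by
      obtain ⟨n, s, h0, hn, hs⟩ := this ⊤ h
      exact ⟨n, s, h0, hn n le_rfl, hs⟩
    intro A hA
    induction hA with
    | refl => exact ⟨0, fun _ => ⊥, rfl, fun _ _ => rfl, fun _ => inferInstance, by simp⟩
    | @tail A B _ hAB ih =>
      obtain ⟨n, s, h0, hn, hs, hc⟩ := ih
      obtain ⟨-, hB, g, hg⟩ := hAB
      refine ⟨n + 1, fun i => if i ≤ n then s i else B, by simpa using h0, ?_, ?_, ?_⟩
      · intro i hi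
        simp [show ¬ i ≤ n by omega]
      · intro i
        by_cases hi : i ≤ n
        · simpa [hi] using hs i
        · simpa [hi] using hB
      · intro i hi
        by_cases hi' : i < n
        · simpa [hi'.le, Nat.succ_le_of_lt hi'] using hc i hi'
        · obtain rfl : i = n := by omega
          exact ⟨g, by simpa [hn i le_rfl] using hg⟩

theorem IsSupersolvable.of_surjective {H : Type*} [Group H] (h : IsSupersolvable G) (f : G →* H)
    (hf : Function.Surjective f) : IsSupersolvable H := by
  obtain ⟨n, s, h0, hn, hs, hc⟩ := h
  refine ⟨n, fun i => (s i).map f, by simp [h0], ?_, fun i => (hs i).map f hf, fun i hi => ?_⟩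
  · simp only [hn, map_top_of_surjective f hf]
  · obtain ⟨g, hg⟩ := hc i hi
    exact ⟨f g, by rw [← MonoidHom.map_zpowers, ← Subgroup.map_sup, hg]⟩

theorem CyclicStep.comap_mk {N : Subgroup G} [N.Normal] {A B : Subgroup (G ⧸ N)}
    (h : CyclicStep A B) :
    CyclicStep (A.comap (QuotientGroup.mk' N)) (B.comap (QuotientGroup.mk' N)) := by
  obtain ⟨hA, hB, g, hg⟩ := h
  obtain ⟨g, rfl⟩ := QuotientGroup.mk'_surjective N g
  refine ⟨inferInstance, inferInstance, g, ?_⟩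
  rw [← hg, ← MonoidHom.map_zpowers, ← comap_sup_eq _ _ _ (QuotientGroup.mk'_surjective N),
    comap_map_eq, ← sup_assoc, eq_comm, sup_eq_left]
  exact (ker_le_comap _ _).trans le_sup_left

theorem reflTransGen_cyclicStep_of_quotient {N : Subgroup G} [N.Normal]
    (h : IsSupersolvable (G ⧸ N)) : Relation.ReflTransGen CyclicStep N ⊤ := by
  have := (isSupersolvable_iff.1 h).lift (comap (QuotientGroup.mk' N)) fun _ _ =>
    CyclicStep.comap_mk
  rwa [Function.onFun, MonoidHom.comap_bot, QuotientGroup.ker_mk', comap_top] at this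

theorem IsSupersolvable.of_quotient_zpowers (g : G) [hg : (zpowers g).Normal]
    (h : IsSupersolvable (G ⧸ zpowers g)) : IsSupersolvable G :=
  isSupersolvable_iff.2 <| (reflTransGen_cyclicStep_of_quotient h).head
    ⟨inferInstance, hg, g, bot_sup_eq _⟩

theorem IsSupersolvable.of_quotient_card_prime {N : Subgroup G} [hN : N.Normal]
    (hp : (Nat.card N).Prime) (h : IsSupersolvable (G ⧸ N)) : IsSupersolvable G := by
  have := Fact.mk hp
  have : IsCyclic N := isCyclic_of_prime_card rfl
  obtain ⟨g, rfl⟩ := N.isCyclic_iff_exists_zpowers_eq_top.1 this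
  exact .of_quotient_zpowers g h

theorem CyclicStep.inf {A B : Subgroup G} (h : CyclicStep A B) (N : Subgroup G) [N.Normal] :
    CyclicStep (A ⊓ N) (B ⊓ N) := by
  obtain ⟨hA, hB, g, rfl⟩ := h
  have : IsCyclic ((A ⊔ N) ⊓ zpowers g : Subgroup G) :=
    isCyclic_of_injective (inclusion inf_le_right) (inclusion_injective _)
  obtain ⟨⟨u, hu⟩, hgen⟩ := IsCyclic.exists_generator (α := ((A ⊔ N) ⊓ zpowers g : Subgroup G))
  obtain ⟨a, ha, h, hh, rfl⟩ := mem_sup_of_normal_right.1 hu.1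
  have hmk : QuotientGroup.mk' A (a * h) = QuotientGroup.mk' A h := by
    rw [map_mul, (QuotientGroup.eq_one_iff a).2 ha |> fun e => (e : QuotientGroup.mk' A a = 1),
      one_mul]
  have hhB : h ∈ A ⊔ zpowers g := by
    have := mul_mem (inv_mem (mem_sup_left ha : a ∈ A ⊔ zpowers g)) (mem_sup_right hu.2)
    simpa using this
  refine ⟨inferInstance, inferInstance, h, le_antisymm ?_ ?_⟩
  · exact sup_le (inf_le_inf_right _ le_sup_left) (by simpa using ⟨hhB, hh⟩)
  · rintro x ⟨hxB, hxN⟩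
    obtain ⟨b, hb, y, hy, rfl⟩ := mem_sup_of_normal_left.1 hxB
    have hyA : y ∈ A ⊔ N := by
      have := mul_mem (inv_mem (mem_sup_left hb : b ∈ A ⊔ N)) (mem_sup_right hxN)
      simpa using this
    obtain ⟨m, hm⟩ := mem_zpowers_iff.1 (hgen ⟨y, hyA, hy⟩)
    have hm' : (a * h) ^ m = y := congrArg Subtype.val hm
    have hbm : b * y * (h ^ m)⁻¹ ∈ A ⊓ N := by
      refine ⟨?_, N.mul_mem hxN (N.inv_mem (N.zpow_mem hh m))⟩
      have hb1 : QuotientGroup.mk' A b = 1 := (QuotientGroup.eq_one_iff b).2 hb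
      refine (QuotientGroup.eq_one_iff _).1 ?_
      change QuotientGroup.mk' A (b * y * (h ^ m)⁻¹) = 1
      rw [map_mul, map_mul, hb1, one_mul, ← hm', map_zpow, hmk, map_inv, map_zpow, mul_inv_cancel]
    have := mul_mem_sup hbm (zpow_mem (mem_zpowers h) m)
    simpa using this

theorem IsSupersolvable.of_inf_eq_bot {A B : Subgroup G} [A.Normal] [B.Normal] (h : A ⊓ B = ⊥)
    (hA : IsSupersolvable (G ⧸ A)) (hB : IsSupersolvable (G ⧸ B)) : IsSupersolvable G := by
  have h1 := (reflTransGen_cyclicStep_of_quotient hB).lift (· ⊓ A) fun _ _ h => h.inf A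
  simp only [Function.onFun, top_inf_eq, inf_comm B A, h] at h1
  exact isSupersolvable_iff.2 (h1.trans (reflTransGen_cyclicStep_of_quotient hA))

theorem normal_zpowers_pow (g : G) (hg : (zpowers g).Normal) (k : ℕ) :
    (zpowers (g ^ k)).Normal := by
  refine ⟨fun x hx y => ?_⟩
  obtain ⟨m, rfl⟩ := mem_zpowers_iff.1 hx
  obtain ⟨j, hj⟩ := mem_zpowers_iff.1 (hg.conj_mem g (mem_zpowers g) y)
  refine mem_zpowers_iff.2 ⟨j * m, ?_⟩
  rw [← conj_zpow, ← conj_pow, ← hj, ← zpow_natCast, ← zpow_natCast, ← zpow_mul, ← zpow_mul,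
    ← zpow_mul]
  congr 1; ring

theorem IsSupersolvable.exists_normal_card_prime [Finite G] [Nontrivial G]
    (h : IsSupersolvable G) : ∃ N : Subgroup G, N.Normal ∧ (Nat.card N).Prime := by
  suffices ∃ g : G, (zpowers g).Normal ∧ g ≠ 1 by
    obtain ⟨g, hg, hg1⟩ := this
    have h1 : orderOf g ≠ 1 := by simpa
    refine ⟨_, normal_zpowers_pow g hg (orderOf g / (orderOf g).minFac), ?_⟩
    rw [Nat.card_zpowers, orderOf_pow_orderOf_div (orderOf_pos g).ne' (Nat.minFac_dvd _)]
    exact Nat.minFac_prime h1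
  have key : ∀ A : Subgroup G, Relation.ReflTransGen CyclicStep ⊥ A → A ≠ ⊥ →
      ∃ g : G, (zpowers g).Normal ∧ g ≠ 1 := by
    intro A hA
    induction hA with
    | refl => simp
    | @tail A B _ hAB ih =>
      intro hB
      by_cases hA : A = ⊥
      · obtain ⟨-, hn, g, hg⟩ := hAB
        rw [hA, bot_sup_eq] at hg
        refine ⟨g, hg ▸ hn, ?_⟩
        rintro rfl
        exact hB (by simpa using hg.symm)
      · exact ih hA
  exact key ⊤ (isSupersolvable_iff.1 h) top_ne_bot

end Supersolvable

section Consequences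

open Subgroup

universe u

section

variable {G : Type*} [Group G]

theorem Subgroup.card_quotient_lt [Finite G] {N : Subgroup G} (hN : N ≠ ⊥) :
    Nat.card (G ⧸ N) < Nat.card G := by
  rw [Subgroup.card_eq_card_quotient_mul_card_subgroup N]
  have h1 : 1 < Nat.card N := N.one_lt_card_iff_ne_bot.2 hN
  exact lt_mul_of_one_lt_right Nat.card_pos h1

theorem Subgroup.card_lt_of_ne_top [Finite G] {Y : Subgroup G} (hY : Y ≠ ⊤) :
    Nat.card Y < Nat.card G :=
  lt_of_le_of_ne Y.card_le_card_group fun h => hY (Y.card_eq_iff_eq_top.1 h)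

theorem Subgroup.ne_bot_of_card_prime {N : Subgroup G} (h : (Nat.card N).Prime) : N ≠ ⊥ := by
  rintro rfl
  simp [Nat.not_prime_one] at h

theorem IsSupersolvable.quotient (h : IsSupersolvable G) (N : Subgroup G) [N.Normal] :
    IsSupersolvable (G ⧸ N) :=
  h.of_surjective _ (QuotientGroup.mk'_surjective N)

end

theorem isSupersolvable_of_subsingleton {G : Type*} [Group G] [Subsingleton G] :
    IsSupersolvable G :=
  isSupersolvable_iff.2 (by rw [Subsingleton.elim (⊥ : Subgroup G) ⊤])

theorem Subgroup.inf_eq_bot_of_card_prime {G : Type*} [Group G] {H N : Subgroup G}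
    (hN : (Nat.card N).Prime) (h : ¬ N ≤ H) : N ⊓ H = ⊥ := by
  have := Nat.finite_of_card_ne_zero hN.ne_zero
  rcases (Nat.dvd_prime hN).1 (card_dvd_of_le (inf_le_left : N ⊓ H ≤ N)) with h1 | h1
  · exact card_eq_one.1 h1
  · exact (h (inf_eq_left.1 (eq_of_le_of_card_ge inf_le_left h1.ge))).elim

theorem Subgroup.covBy_sup_of_card_prime {G : Type*} [Group G] [Finite G] {H N : Subgroup G}
    [N.Normal] (hN : (Nat.card N).Prime) (h : ¬ N ≤ H) :
    H ⋖ H ⊔ N ∧ Ω H.index = Ω (H ⊔ N).index + 1 := by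
  have h1 : H.relIndex (H ⊔ N) = Nat.card N := by
    have h2 : N.relIndex (H ⊔ N) = N.relIndex H := relIndex_sup_right H N
    have h3 := relIndex_mul_relIndex (⊥ : Subgroup G) H (H ⊔ N) bot_le le_sup_left
    have h4 := relIndex_mul_relIndex (⊥ : Subgroup G) N (H ⊔ N) bot_le le_sup_right
    rw [← inf_relIndex_right N H, inf_eq_bot_of_card_prime hN h, relIndex_bot_left] at h2
    rw [← h3, h2, relIndex_bot_left, relIndex_bot_left, mul_comm] at h4
    exact (Nat.eq_of_mul_eq_mul_left Nat.card_pos h4).symm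
  refine ⟨covBy_of_relIndex_prime le_sup_left (h1 ▸ hN), ?_⟩
  rw [← relIndex_mul_index (le_sup_left : H ≤ H ⊔ N), h1,
    ArithmeticFunction.cardFactors_mul hN.ne_zero index_ne_zero_of_finite,
    ArithmeticFunction.cardFactors_eq_one_iff_prime.2 hN, add_comm]

theorem IsSupersolvable.coverChain {G : Type u} [Group G] [Finite G] (h : IsSupersolvable G)
    (H : Subgroup G) : CoverChain H ⊤ (Ω H.index) := by
  induction hn : Nat.card G using Nat.strong_induction_on generalizing G with
  | h n ih =>
    subst hn
    rcases subsingleton_or_nontrivial G with hG | hG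
    · rw [Subsingleton.elim H ⊤]
      simpa using CoverChain.refl _
    obtain ⟨N, hNn, hN⟩ := h.exists_normal_card_prime
    have h1 := (ih _ (card_quotient_lt (ne_bot_of_card_prime hN)) (h.quotient N)
      (H.map (QuotientGroup.mk' N)) rfl).comap_mk
    rw [comap_map_eq, comap_top, index_map, QuotientGroup.ker_mk',
      MonoidHom.range_eq_top.2 (QuotientGroup.mk'_surjective N), index_top, mul_one] at h1
    by_cases hNH : N ≤ H
    · rwa [sup_eq_left.2 hNH] at h1
    · obtain ⟨hc, hi⟩ := covBy_sup_of_card_prime hN hNH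
      exact hi ▸ .cons hc h1

theorem IsPGroup.isSupersolvable {p : ℕ} [Fact p.Prime] {G : Type u} [Group G] [Finite G]
    (h : IsPGroup p G) : IsSupersolvable G := by
  induction hn : Nat.card G using Nat.strong_induction_on generalizing G with
  | h n ih =>
    subst hn
    rcases subsingleton_or_nontrivial G with hG | hG
    · exact isSupersolvable_of_subsingleton
    have := h.center_nontrivial
    obtain ⟨N, hNZ, hN⟩ := exists_le_card_prime ((nontrivial_iff_ne_bot _).1 this)
    have : N.Normal := ⟨fun n hn g => by
      rwa [← (mem_center_iff.1 (hNZ hn) g).symm, mul_inv_cancel_right]⟩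
    exact .of_quotient_card_prime hN
      (ih _ (card_quotient_lt (ne_bot_of_card_prime hN)) (h.to_quotient N) rfl)

theorem IsSupersolvable.isSolvable {G : Type u} [Group G] [Finite G]
    (h : IsSupersolvable G) : Group.IsSolvable G := by
  induction hn : Nat.card G using Nat.strong_induction_on generalizing G with
  | h n ih =>
    subst hn
    rcases subsingleton_or_nontrivial G with hG | hG
    · infer_instance
    obtain ⟨N, hNn, hN⟩ := h.exists_normal_card_prime
    have := ih _ (card_quotient_lt (ne_bot_of_card_prime hN)) (h.quotient N) rfl
    have := Fact.mk hN
    have : IsCyclic N := isCyclic_of_prime_card rfl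
    exact Group.isSolvable_of_ker_le_range N.subtype (QuotientGroup.mk' N) (by simp)

theorem Subgroup.commute_of_card_prime {G : Type*} [Group G] [Finite G] {N : Subgroup G}
    [N.Normal] (hN : (Nat.card N).Prime) {x : G}
    (hx : (orderOf x).Coprime (Nat.card N - 1)) {n : G} (hn : n ∈ N) : Commute x n := by
  have := Fact.mk hN
  have : IsCyclic N := isCyclic_of_prime_card rfl
  have h1 : orderOf (MulAut.conjNormal x : MulAut N) ∣ Nat.card N - 1 := by
    rw [← Nat.totient_prime hN, ← IsCyclic.card_mulAut N]
    exact _root_.orderOf_dvd_natCard _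
  have h2 : orderOf (MulAut.conjNormal x : MulAut N) = 1 :=
    Nat.eq_one_of_dvd_coprimes hx (orderOf_map_dvd (MulAut.conjNormal (H := N)) x) h1
  rw [orderOf_eq_one_iff] at h2
  have := congrArg Subtype.val (DFunLike.congr_fun h2 ⟨n, hn⟩)
  rw [MulAut.conjNormal_apply] at this
  exact mul_inv_eq_iff_eq_mul.1 this

theorem IsSupersolvable.commute_of_coprime {p : ℕ} [Fact p.Prime] {G : Type u} [Group G]
    [Finite G] (h : IsSupersolvable G) {D : Subgroup G} [D.Normal] (hD : IsPGroup p D) {x : G}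
    (hx : (orderOf x).Coprime p) (hx' : (orderOf x).Coprime (p - 1)) {d : G} (hd : d ∈ D) :
    Commute x d := by
  induction hn : Nat.card G using Nat.strong_induction_on generalizing G with
  | h n ih =>
    subst hn
    rcases subsingleton_or_nontrivial G with hG | hG
    · exact Subsingleton.elim _ _
    obtain ⟨N, hNn, hN⟩ := h.exists_normal_card_prime
    have hDN : (D.map (QuotientGroup.mk' N)).Normal :=
      Normal.map inferInstance _ (QuotientGroup.mk'_surjective N)
    have h1 := ih _ (card_quotient_lt (ne_bot_of_card_prime hN)) (h.quotient N)
      (D := D.map (QuotientGroup.mk' N)) (hD.map _) (x := QuotientGroup.mk' N x)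
      (hx.coprime_dvd_left (orderOf_map_dvd _ _)) (hx'.coprime_dvd_left (orderOf_map_dvd _ _))
      (mem_map_of_mem _ hd) rfl
    set c := x * d * x⁻¹ * d⁻¹ with hc
    have hcN : c ∈ N := by
      rw [← QuotientGroup.eq_one_iff]
      change QuotientGroup.mk' N (x * d * x⁻¹ * d⁻¹) = 1
      rw [map_mul, map_mul, map_inv, map_inv, map_mul, h1.eq]
      simp
    have hcD : c ∈ D := D.mul_mem (Normal.conj_mem inferInstance d hd x) (D.inv_mem hd)
    have hxd : x * d * x⁻¹ = c * d := by simp [hc]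
    by_cases hc1 : c = 1
    · rw [hc1, one_mul] at hxd
      exact mul_inv_eq_iff_eq_mul.1 hxd
    obtain ⟨k, hk⟩ := hD ⟨c, hcD⟩
    have hk : c ^ p ^ k = 1 := congrArg Subtype.val hk
    have hoN : orderOf c = Nat.card N := by
      have := orderOf_dvd_natCard (⟨c, hcN⟩ : N)
      rw [Subgroup.orderOf_mk] at this
      exact ((Nat.dvd_prime hN).1 this).resolve_left (by simpa using hc1)
    have hNp : Nat.card N = p :=
      (Nat.prime_dvd_prime_iff_eq hN Fact.out).1
        (hN.dvd_of_dvd_pow (hoN ▸ orderOf_dvd_of_pow_eq_one hk))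
    have hxc : Commute x c := commute_of_card_prime hN (by rwa [hNp]) hcN
    have hpow : ∀ m : ℕ, x ^ m * d * (x ^ m)⁻¹ = c ^ m * d := by
      intro m
      induction m with
      | zero => simp
      | succ m ihm =>
        calc x ^ (m + 1) * d * (x ^ (m + 1))⁻¹ = x * (x ^ m * d * (x ^ m)⁻¹) * x⁻¹ := by
              rw [pow_succ']; group
          _ = x * c ^ m * (d * x⁻¹) := by rw [ihm]; group
          _ = c ^ m * (x * d * x⁻¹) := by rw [(hxc.pow_right m).eq]; group
          _ = c ^ (m + 1) * d := by rw [hxd, pow_succ]; group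
    have h2 := hpow (orderOf x)
    rw [pow_orderOf_eq_one, one_mul, inv_one, mul_one, eq_comm, mul_eq_right] at h2
    have h3 := Nat.eq_one_of_dvd_coprimes hx (orderOf_dvd_of_pow_eq_one h2) (hoN.trans hNp).dvd
    exact (hc1 (orderOf_eq_one_iff.1 h3)).elim

theorem IsSupersolvable.sylow_normal {p : ℕ} [hp : Fact p.Prime] {G : Type u} [Group G]
    [Finite G] (h : IsSupersolvable G) (hq : ∀ q, q.Prime → q ∣ Nat.card G → q ≤ p)
    (S : Sylow p G) : S.Normal := by
  induction hn : Nat.card G using Nat.strong_induction_on generalizing G with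
  | h n ih =>
    subst hn
    rcases subsingleton_or_nontrivial G with hG | hG
    · rw [Subsingleton.elim (S : Subgroup G) ⊤]; infer_instance
    obtain ⟨N, hNn, hN⟩ := h.exists_normal_card_prime
    have hnorm := ih _ (card_quotient_lt (ne_bot_of_card_prime hN)) (h.quotient N)
      (fun q hq' hqd => hq q hq' (hqd.trans (card_quotient_dvd_card N)))
      (S.mapSurjective (QuotientGroup.mk'_surjective N)) rfl
    have hSN : (S ⊔ N : Subgroup G).Normal := by
      have := hnorm.comap (QuotientGroup.mk' N)
      rwa [Sylow.coe_mapSurjective, comap_map_eq, QuotientGroup.ker_mk'] at this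
    rcases (hq _ hN N.card_subgroup_dvd_card).eq_or_lt with hNp | hNp
    · have hNS : N ≤ S := (IsPGroup.of_card (n := 1) (by rw [hNp, pow_one])).le_sylow_of_normal S
      rwa [sup_eq_left.2 hNS] at hSN
    · have hNS : N ≤ normalizer S := by
        refine le_trans (fun n hn => ?_) (centralizer_le_normalizer (S : Set G))
        refine mem_centralizer_iff.2 fun s hs => ?_
        refine commute_of_card_prime hN ?_ hn
        obtain ⟨k, hk⟩ := S.isPGroup' ⟨s, hs⟩
        have hk : s ^ p ^ k = 1 := congrArg Subtype.val hk
        refine Nat.Coprime.coprime_dvd_left (orderOf_dvd_of_pow_eq_one hk)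
          (Nat.Coprime.pow_left _ ?_)
        have := hN.two_le
        exact Nat.coprime_of_lt_prime (by omega) (by omega) hp.out
      rw [← normalizer_eq_top_iff,
        ← Sylow.normalizer_sup_eq_top' S (le_sup_left : _ ≤ (S : Subgroup G) ⊔ N),
        S.coe_coe, eq_comm, sup_eq_left]
      exact sup_le le_normalizer hNS

theorem Subgroup.le_centralizer_of_isNilpotent {G : Type*} [Group G] {N Q : Subgroup G}
    [N.Normal] [Q.Normal] (hQ : Group.IsNilpotent Q)
    (hN : ∀ K : Subgroup G, K.Normal → K ≠ ⊥ → K ≤ N → K = N) (hNQ : N ≤ Q) :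
    N ≤ centralizer Q := by
  rw [← commutator_eq_bot_iff_le_centralizer]
  by_contra h
  have h1 := hN ⁅N, Q⁆ inferInstance h (commutator_le_left _ _)
  obtain ⟨n, hn⟩ := (isNilpotent_iff_lowerCentralSeries _).1 hQ
  have h2 : ∀ n, N ≤ Q.lowerCentralSeries n := by
    intro n
    induction n with
    | zero => exact hNQ
    | succ n ih =>
      rw [lowerCentralSeries_succ, ← h1]
      exact commutator_mono ih le_rfl
  have : N = ⊥ := le_bot_iff.1 (hn ▸ h2 n)
  subst this
  exact h h1

end Consequences

section MonolithSplitting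

open Subgroup

universe u

variable {G : Type u} [Group G]

theorem IsSupersolvable.coverChain_of_le [Finite G] {H Y : Subgroup G} (h : IsSupersolvable Y)
    (hHY : H ≤ Y) : CoverChain H Y (Ω (H.relIndex Y)) := by
  simpa [subgroupOf_map_subtype, hHY, relIndex] using
    (h.coverChain (H.subgroupOf Y)).map_subtype_top

theorem IsSupersolvable.coverChain_of_quotient [Finite G] {N H : Subgroup G} [N.Normal]
    (h : IsSupersolvable (G ⧸ N)) (hNH : N ≤ H) : CoverChain H ⊤ (Ω H.index) := by
  have h1 := (h.coverChain (H.map (QuotientGroup.mk' N))).comap_mk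
  rwa [comap_map_eq, comap_top, QuotientGroup.ker_mk', sup_eq_left.2 hNH,
    index_map_eq _ (QuotientGroup.mk'_surjective N) (by simpa using hNH)] at h1

theorem Subgroup.card_mul_relIndex_of_le {H K : Subgroup G} (h : H ≤ K) :
    Nat.card H * H.relIndex K = Nat.card K := by
  rw [← relIndex_bot_left, ← relIndex_bot_left, relIndex_mul_relIndex _ _ _ bot_le h]

theorem Subgroup.cardFactors_card_of_le [Finite G] {H K : Subgroup G} (h : H ≤ K) :
    Ω (Nat.card K) = Ω (Nat.card H) + Ω (H.relIndex K) := by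
  rw [← card_mul_relIndex_of_le h, ArithmeticFunction.cardFactors_mul Nat.card_pos.ne'
    (relIndex_ne_zero_of_finite _ _)]

theorem Subgroup.mk_comp_subtype_surjective {N M : Subgroup G} [N.Normal] (h : N ⊔ M = ⊤) :
    Function.Surjective ((QuotientGroup.mk' N).comp M.subtype) := by
  intro x
  obtain ⟨g, rfl⟩ := QuotientGroup.mk'_surjective N x
  obtain ⟨n, hn, m, hm, rfl⟩ := mem_sup_of_normal_left.1 (h ▸ mem_top g)
  refine ⟨⟨m, hm⟩, ?_⟩
  have h1 : QuotientGroup.mk' N n = 1 := (QuotientGroup.eq_one_iff n).2 hn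
  rw [map_mul, h1, one_mul]
  rfl

theorem Subgroup.mk_comp_subtype_injective {N M : Subgroup G} [N.Normal] (h : N ⊓ M = ⊥) :
    Function.Injective ((QuotientGroup.mk' N).comp M.subtype) := by
  rw [injective_iff_map_eq_one]
  intro m hm
  have : (m : G) ∈ N ⊓ M := ⟨(QuotientGroup.eq_one_iff _).1 hm, m.2⟩
  rw [h, mem_bot] at this
  exact Subtype.ext this

theorem IsSupersolvable.quotient_of_sup_eq_top {N M : Subgroup G} [N.Normal]
    (hM : IsSupersolvable M) (h : N ⊔ M = ⊤) : IsSupersolvable (G ⧸ N) :=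
  hM.of_surjective _ (mk_comp_subtype_surjective h)

theorem IsSupersolvable.of_quotient_complement {N M : Subgroup G} [N.Normal]
    (hN : IsSupersolvable (G ⧸ N)) (h : N ⊔ M = ⊤) (h' : N ⊓ M = ⊥) : IsSupersolvable M :=
  hN.of_surjective (MulEquiv.ofBijective _
    ⟨mk_comp_subtype_injective h', mk_comp_subtype_surjective h⟩).symm.toMonoidHom
    (MulEquiv.surjective _)

theorem Subgroup.card_eq_index_of_complement {N M : Subgroup G} [N.Normal] (h : N ⊔ M = ⊤)
    (h' : N ⊓ M = ⊥) : Nat.card M = N.index :=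
  Nat.card_eq_of_bijective _ ⟨mk_comp_subtype_injective h', mk_comp_subtype_surjective h⟩

/-- `N` is the unique minimal normal subgroup, of order `p ^ n` and self-centralizing, and `M` is
a supersolvable maximal subgroup complementing it. -/
structure MonolithSplitting (N M : Subgroup G) (p n : ℕ) : Prop where
  normal : N.Normal
  ne_bot : N ≠ ⊥
  le_of_normal : ∀ K : Subgroup G, K.Normal → K ≠ ⊥ → N ≤ K
  prime : p.Prime
  two_le : 2 ≤ n
  card_eq : Nat.card N = p ^ n
  centralizer_eq : centralizer (N : Set G) = N
  isCoatom : IsCoatom M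
  isSupersolvable : IsSupersolvable M
  inf_eq_bot : N ⊓ M = ⊥
  sup_eq_top : N ⊔ M = ⊤

namespace MonolithSplitting

variable {N M : Subgroup G} {p n : ℕ}

theorem isSolvable [Finite G] (h : MonolithSplitting N M p n) : Group.IsSolvable G := by
  have := h.normal
  have := Fact.mk h.prime
  have := (h.isSupersolvable.quotient_of_sup_eq_top h.sup_eq_top).isSolvable
  have := (IsPGroup.of_card h.card_eq).isSupersolvable.isSolvable
  exact Group.isSolvable_of_ker_le_range N.subtype (QuotientGroup.mk' N) (by simp)

theorem exists_coverChain [Finite G] (h : MonolithSplitting N M p n) :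
    ∃ (A B : Subgroup G) (a b : ℕ), Nat.card A = p ∧ (Nat.card B).Prime ∧
      CoverChain A ⊤ a ∧ CoverChain B ⊤ b ∧ b < a := by
  have := h.normal
  have := Fact.mk h.prime
  obtain ⟨A, hAN, hA⟩ := exists_le_card_prime h.ne_bot
  have hAp : Nat.card A = p :=
    (Nat.prime_dvd_prime_iff_eq hA h.prime).1
      (hA.dvd_of_dvd_pow (h.card_eq ▸ card_dvd_of_le hAN))
  have hrel := cardFactors_card_of_le hAN
  have hn : Ω (Nat.card N) = n := by
    rw [h.card_eq, ArithmeticFunction.cardFactors_apply_prime_pow h.prime]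
  rw [ArithmeticFunction.cardFactors_apply_prime hA] at hrel
  have h2 := h.two_le
  have hMbot : M ≠ ⊥ := by
    rintro rfl
    have hAtop : A = ⊤ := h.isCoatom.2 A (bot_lt_iff_ne_bot.2 (ne_bot_of_card_prime hA))
    rw [relIndex_eq_one.2 (hAtop ▸ le_top)] at hrel
    simp only [ArithmeticFunction.cardFactors_one] at hrel
    omega
  obtain ⟨B, hBM, hB⟩ := exists_le_card_prime hMbot
  have hA1 := (IsPGroup.of_card h.card_eq).isSupersolvable.coverChain_of_le hAN
  have hA2 := (h.isSupersolvable.quotient_of_sup_eq_top h.sup_eq_top).coverChain_of_quotient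
    (le_refl N)
  have hB1 := h.isSupersolvable.coverChain_of_le hBM
  refine ⟨A, B, _, _, hAp, hB, hA1.trans hA2, hB1.trans (.single h.isCoatom.covBy_top), ?_⟩
  have hrelB := cardFactors_card_of_le hBM
  rw [ArithmeticFunction.cardFactors_apply_prime hB,
    card_eq_index_of_complement h.sup_eq_top h.inf_eq_bot] at hrelB
  omega

end MonolithSplitting

end MonolithSplitting

section Frobenius

open Subgroup

open scoped Pointwise

variable {G : Type*} [Group G]

/-- Elements of order prime to `p` normalizing a nontrivial `p`-subgroup centralize it. -/
def CentralizesLocally (G : Type*) [Group G] (p : ℕ) : Prop :=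
  ∀ D : Subgroup G, D ≠ ⊥ → IsPGroup p D → ∀ x ∈ normalizer (D : Set G),
    (orderOf x).Coprime p → x ∈ centralizer (D : Set G)

theorem IsPGroup.quotient_of_coprime_mem [Finite G] {p : ℕ} [Fact p.Prime] {C : Subgroup G}
    [C.Normal] (hC : ∀ x : G, (orderOf x).Coprime p → x ∈ C) : IsPGroup p (G ⧸ C) := by
  intro x
  obtain ⟨g, rfl⟩ := QuotientGroup.mk'_surjective C x
  obtain ⟨k, m, hm, hg⟩ := Nat.exists_eq_pow_mul_and_not_dvd (orderOf_pos g).ne' p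
    (Fact.out : p.Prime).ne_one
  refine ⟨k, ?_⟩
  rw [← map_pow]
  refine (QuotientGroup.eq_one_iff _).2 (hC _ ?_)
  have : orderOf (g ^ p ^ k) ∣ m := orderOf_dvd_of_pow_eq_one (by
    rw [← pow_mul, ← hg, pow_orderOf_eq_one])
  refine Nat.Coprime.coprime_dvd_left this ?_
  exact ((Nat.Prime.coprime_iff_not_dvd Fact.out).2 hm).symm

theorem Sylow.exists_mul_of_isPGroup_quotient [Finite G] {p : ℕ} [Fact p.Prime] {C : Subgroup G}
    [C.Normal] (hC : IsPGroup p (G ⧸ C)) (V : Sylow p G) (g : G) :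
    ∃ c ∈ C, ∃ v ∈ V, g = c * v := by
  have h1 : (V.mapSurjective (QuotientGroup.mk'_surjective C) : Subgroup (G ⧸ C)) = ⊤ :=
    ((V.mapSurjective _).is_maximal' (hC.to_subgroup ⊤) le_top).symm
  have h2 : QuotientGroup.mk' C g ∈ (⊤ : Subgroup (G ⧸ C)) := mem_top _
  rw [← h1, Sylow.coe_mapSurjective] at h2
  obtain ⟨v, hv, hvg⟩ := h2
  refine ⟨g * v⁻¹, ?_, v, hv, by simp⟩
  rw [← QuotientGroup.eq_one_iff]
  change QuotientGroup.mk' C (g * v⁻¹) = 1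
  rw [map_mul, map_inv, hvg, mul_inv_cancel]

theorem Sylow.mem_coe_smul_iff {p : ℕ} {g x : G} {S : Sylow p G} :
    x ∈ ((g • S : Sylow p G) : Subgroup G) ↔ g⁻¹ * x * g ∈ (S : Subgroup G) := by
  rw [Sylow.coe_subgroup_smul, Subgroup.mem_pointwise_smul_iff_inv_smul_mem, MulAut.smul_def,
    ← map_inv, MulAut.conj_apply, inv_inv]

theorem IsPGroup.lt_inf_normalizer [Finite G] {p : ℕ} [Fact p.Prime] {D S : Subgroup G}
    (hS : IsPGroup p S) (h : D < S) : D < S ⊓ normalizer D := by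
  have := hS.isNilpotent
  have h1 : D.subgroupOf S < ⊤ := by
    rw [lt_top_iff_ne_top, Ne, subgroupOf_eq_top]
    exact h.not_ge
  have h2 := Group.normalizerCondition_of_isNilpotent _ h1
  rw [← subgroupOf_normalizer_eq h.le] at h2
  have h3 := (map_lt_map_iff_of_injective S.subtype_injective).2 h2
  rwa [subgroupOf_map_subtype, subgroupOf_map_subtype, inf_eq_left.2 h.le, inf_comm] at h3

namespace CentralizesLocally

variable [Finite G] {p : ℕ} [Fact p.Prime]

theorem isPGroup_quotient (h : CentralizesLocally G p) {D : Subgroup G} (hD : D ≠ ⊥)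
    (hDp : IsPGroup p D) :
    IsPGroup p (normalizer (D : Set G) ⧸
      (centralizer (D : Set G)).subgroupOf (normalizer (D : Set G))) :=
  .quotient_of_coprime_mem fun x hx => mem_subgroupOf.2 <|
    h D hD hDp x x.2 (by rwa [Subgroup.orderOf_coe])

theorem exists_smul_eq (h : CentralizesLocally G p) (S T : Sylow p G) :
    ∃ c ∈ centralizer ((S ⊓ T : Subgroup G) : Set G), c • S = T := by
  induction hn : Nat.card G - Nat.card (S ⊓ T : Subgroup G) using Nat.strong_induction_on
    generalizing S T with
  | h n ih =>
    subst hn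
    rcases eq_or_ne S T with rfl | hST
    · exact ⟨1, one_mem _, one_smul _ _⟩
    rcases eq_or_ne (S ⊓ T : Subgroup G) ⊥ with hD | hD
    · obtain ⟨g, hg⟩ := MulAction.exists_smul_eq G S T
      exact ⟨g, by simp [hD, mem_centralizer_iff], hg⟩
    have ih' : ∀ S' T' : Sylow p G, (S ⊓ T : Subgroup G) < (S' ⊓ T' : Subgroup G) →
        ∃ c ∈ centralizer ((S ⊓ T : Subgroup G) : Set G), c • S' = T' := by
      intro S' T' hlt
      have h1 : Nat.card (S ⊓ T : Subgroup G) < Nat.card (S' ⊓ T' : Subgroup G) :=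
        Set.Finite.card_lt_card (Set.toFinite _) hlt
      have h2 := (S' ⊓ T' : Subgroup G).card_le_card_group
      obtain ⟨c, hc, hc'⟩ := ih _ (by omega) S' T' rfl
      exact ⟨c, centralizer_le hlt.le hc, hc'⟩
    set D : Subgroup G := S ⊓ T with hDdef
    have hDS : D < S := inf_le_left.lt_of_ne fun h =>
      hST (Sylow.ext (S.is_maximal' T.isPGroup' (h ▸ inf_le_right : (S : Subgroup G) ≤ T))).symm
    have hDT : D < T := inf_le_right.lt_of_ne fun h =>
      hST (Sylow.ext (T.is_maximal' S.isPGroup' (h ▸ inf_le_left : (T : Subgroup G) ≤ S)))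
    have hDp : IsPGroup p D := S.isPGroup'.to_le hDS.le
    have hS1 := S.isPGroup'.lt_inf_normalizer hDS
    have hT1 := T.isPGroup'.lt_inf_normalizer hDT
    obtain ⟨V, hV⟩ := ((S.isPGroup'.to_le inf_le_left).comap_subtype :
      IsPGroup p ((S ⊓ normalizer D : Subgroup G).subgroupOf (normalizer D))).exists_le_sylow
    obtain ⟨W, hW⟩ := ((T.isPGroup'.to_le inf_le_left).comap_subtype :
      IsPGroup p ((T ⊓ normalizer D : Subgroup G).subgroupOf (normalizer D))).exists_le_sylow
    obtain ⟨g, hg⟩ := MulAction.exists_smul_eq (normalizer (D : Set G)) V W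
    obtain ⟨c, hc, v, hv, rfl⟩ := V.exists_mul_of_isPGroup_quotient (h.isPGroup_quotient hD hDp) g
    have hcV : c • V = W := by
      rw [← hg, mul_smul, Sylow.smul_eq_iff_mem_normalizer.2 (le_normalizer hv)]
    obtain ⟨U, hU⟩ := (V.isPGroup'.map (normalizer (D : Set G)).subtype).exists_le_sylow
    obtain ⟨a, ha, haU⟩ := ih' S U <| hS1.trans_le <| le_inf inf_le_left fun x hx =>
      hU ⟨⟨x, hx.2⟩, hV (mem_subgroupOf.2 hx), rfl⟩
    have hTU : (T ⊓ normalizer D : Subgroup G) ≤ ((c : G) • U : Sylow p G) := fun x hx => by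
      have h1 : (⟨x, hx.2⟩ : normalizer (D : Set G)) ∈ ((c • V : Sylow p _) : Subgroup _) :=
        hcV ▸ hW (mem_subgroupOf.2 hx)
      exact Sylow.mem_coe_smul_iff.2 (hU ⟨_, Sylow.mem_coe_smul_iff.1 h1, rfl⟩)
    obtain ⟨b, hb, hbU⟩ := ih' ((c : G) • U) T (hT1.trans_le (le_inf hTU inf_le_left))
    refine ⟨b * (c * a), mul_mem hb (mul_mem (mem_subgroupOf.1 hc) ha), ?_⟩
    rw [mul_smul, mul_smul, haU, hbU]

theorem focalSubgroup_le (h : CentralizesLocally G p) (S : Sylow p G) :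
    (S : Subgroup G).focalSubgroup ≤ ⁅(S : Subgroup G), (S : Subgroup G)⁆ := by
  rw [focalSubgroup_def, closure_le]
  rintro _ ⟨hxu, x, hx, u, rfl⟩
  rcases eq_or_ne (S : Subgroup G) ⊥ with hS | hS
  · rw [hS, mem_bot] at hx
    simp [hx]
  have hux : x ∈ ((u⁻¹ • S : Sylow p G) : Subgroup G) := by
    rw [Sylow.mem_coe_smul_iff, inv_inv]
    simpa [commutatorElement_def, mul_assoc] using
      (S : Subgroup G).mul_mem ((S : Subgroup G).inv_mem hxu) hx
  obtain ⟨c, hc, hcS⟩ := h.exists_smul_eq S (u⁻¹ • S)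
  have hN : u * c ∈ normalizer (S : Set G) := by
    rw [← Sylow.smul_eq_iff_mem_normalizer, mul_smul, hcS, smul_inv_smul]
  obtain ⟨z, hz, s, hs, hzs⟩ := (S.subtype le_normalizer).exists_mul_of_isPGroup_quotient
    (h.isPGroup_quotient hS S.isPGroup') ⟨u * c, hN⟩
  have hzs' : u * c = z * s := congrArg Subtype.val hzs
  have hsS : (s : G) ∈ S := hs
  have hcx : x * c = c * x := (mem_centralizer_iff.1 hc) x ⟨hx, hux⟩
  have hzx := (mem_centralizer_iff.1 (mem_subgroupOf.1 hz)) _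
    (S.mul_mem (S.mul_mem hsS hx) (S.inv_mem hsS))
  have hconj : u * x * u⁻¹ = s * x * (s : G)⁻¹ :=
    calc u * x * u⁻¹ = u * (x * c) * c⁻¹ * u⁻¹ := by group
      _ = (u * c) * x * (u * c)⁻¹ := by rw [hcx]; group
      _ = z * (s * x * (s : G)⁻¹) * (z : G)⁻¹ := by rw [hzs']; group
      _ = s * x * (s : G)⁻¹ := by rw [← hzx, mul_inv_cancel_right]
  have hxs := commutator_mem_commutator (H₁ := (S : Subgroup G)) (H₂ := (S : Subgroup G)) hx hsS
  have hcomm (g : G) : x * g * x⁻¹ * g⁻¹ = x * (g * x * g⁻¹)⁻¹ := by group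
  rw [commutatorElement_def, hcomm] at hxs ⊢
  rwa [hconj]

theorem not_dvd_card (h : CentralizesLocally G p) (hG : _root_.commutator G = ⊤) :
    ¬ p ∣ Nat.card G := by
  intro hp
  obtain ⟨S⟩ : Nonempty (Sylow p G) := inferInstance
  have h1 : (S : Subgroup G) ≤ ⁅(S : Subgroup G), (S : Subgroup G)⁆ := by
    have := commutator_inf_eq_focalSubgroup S
    rw [hG, top_inf_eq] at this
    exact this.le.trans (h.focalSubgroup_le S)
  have := S.isPGroup'.isNilpotent
  obtain ⟨n, hn⟩ := (isNilpotent_iff_lowerCentralSeries _).1 this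
  have h2 : ∀ n, (S : Subgroup G) ≤ (S : Subgroup G).lowerCentralSeries n := by
    intro n
    induction n with
    | zero => exact le_rfl
    | succ n ih => exact h1.trans (commutator_mono ih le_rfl)
  exact S.ne_bot_of_dvd_card hp (le_bot_iff.1 (hn ▸ h2 n))

end CentralizesLocally

end Frobenius

section PerfectGroup

open Subgroup

universe u

variable {G : Type u} [Group G]

theorem CoverChain.map_conj {H : Subgroup G} {n : ℕ} (h : CoverChain H ⊤ n) (g : G) :
    CoverChain (H.map (MulAut.conj g).toMonoidHom) ⊤ n := by
  have := h.map fun _ _ => map_covBy_map_of_injective (f := (MulAut.conj g).toMonoidHom)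
    (MulAut.conj g).injective
  rwa [map_top_of_surjective _ (MulAut.conj g).surjective] at this

variable [Finite G]

theorem IsPGroup.coverChain_of_le {p : ℕ} [Fact p.Prime] {H S : Subgroup G} (hS : IsPGroup p S)
    (h : H ≤ S) : CoverChain H S (Ω (H.relIndex S)) :=
  hS.isSupersolvable.coverChain_of_le h

theorem HasEqualAtomChains.eq_of_card_eq (h : HasEqualAtomChains G) {A B : Subgroup G}
    {a b : ℕ} (hA : (Nat.card A).Prime) (hAB : Nat.card A = Nat.card B)
    (ha : CoverChain A ⊤ a) (hb : CoverChain B ⊤ b) : a = b := by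
  have := Fact.mk hA
  obtain ⟨S, hS⟩ := (IsPGroup.of_card (p := Nat.card A) (n := 1) (G := A)
    (by rw [pow_one])).exists_le_sylow
  obtain ⟨T, hT⟩ := (IsPGroup.of_card (p := Nat.card A) (n := 1) (G := B)
    (by rw [pow_one, hAB])).exists_le_sylow
  obtain ⟨g, rfl⟩ := MulAction.exists_smul_eq G S T
  obtain ⟨k, -, hk⟩ := exists_coverChain_le (S : Subgroup G) ⊤ le_top
  have hk' := hk.map_conj g
  have h1 := h A _ _ hA ha ((S.isPGroup'.coverChain_of_le hS).trans hk)
  have h2 := h B _ _ (hAB ▸ hA) hb (((g • S).isPGroup'.coverChain_of_le hT).trans hk')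
  have h3 := cardFactors_card_of_le hS
  have h4 := cardFactors_card_of_le hT
  have h5 : Nat.card ((g • S : Sylow _ G) : Subgroup G) = Nat.card (S : Subgroup G) :=
    Nat.card_congr (Sylow.equiv (g • S) S).toEquiv
  rw [← hAB, h5] at h4
  omega

theorem HasEqualAtomChains.exists_dvd_centralizesLocally [Nontrivial G]
    (h : HasEqualAtomChains G)
    (ih : ∀ Y : Subgroup G, Y ≠ ⊤ → ¬ IsSupersolvable Y →
      ∃ (N M : Subgroup Y) (p n : ℕ), MonolithSplitting N M p n)
    (hsimple : ∀ N : Subgroup G, N.Normal → N ≠ ⊥ → N = ⊤)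
    (hG : _root_.commutator G = ⊤) :
    ∃ p, p.Prime ∧ p ∣ Nat.card G ∧ CentralizesLocally G p := by
  classical
  have hex : ∃ r p, p.Prime ∧ ∃ A : Subgroup G, Nat.card A = p ∧ CoverChain A ⊤ r := by
    obtain ⟨A, -, hA⟩ := exists_le_card_prime (bot_lt_top (α := Subgroup G)).ne'
    obtain ⟨k, -, hk⟩ := exists_coverChain_le A ⊤ le_top
    exact ⟨k, _, hA, A, rfl, hk⟩
  obtain ⟨p, ⟨hp, A, hA, hr⟩, hpmin⟩ := Nat.findX (Nat.find_spec hex)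
  have hrmin (s : ℕ) (B : Subgroup G) (hB : (Nat.card B).Prime) (hs : CoverChain B ⊤ s) :
      Nat.find hex ≤ s := Nat.find_min' hex ⟨_, hB, B, rfl, hs⟩
  generalize Nat.find hex = r at hr hpmin hrmin
  have hAp : (Nat.card A).Prime := hA ▸ hp
  have := Fact.mk hp
  refine ⟨p, hp, hA ▸ A.card_subgroup_dvd_card, fun D hD hDp x hx hxp => ?_⟩
  have hY : normalizer (D : Set G) ≠ ⊤ := fun hY => by
    have hDtop := hsimple D (normalizer_eq_top_iff.1 hY) hD
    have h1 : IsPGroup p G := (hDtop ▸ hDp : IsPGroup p (⊤ : Subgroup G)).of_equiv topEquiv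
    have := h1.isSupersolvable.isSolvable
    exact (Group.IsSolvable.commutator_lt_top_of_nontrivial G).ne hG
  obtain ⟨k, -, hk⟩ := exists_coverChain_le (normalizer (D : Set G)) ⊤ le_top
  have hDY : D ≤ normalizer (D : Set G) := le_normalizer
  have hDY' : D.subgroupOf (normalizer (D : Set G)) ≠ ⊥ := by
    rwa [Ne, subgroupOf_eq_bot, disjoint_iff, inf_eq_left.2 hDY]
  have hDpY : IsPGroup p (D.subgroupOf (normalizer (D : Set G))) := hDp.comap_subtype
  by_cases hss : IsSupersolvable (normalizer (D : Set G))
  · have hxY : ∀ q, q.Prime → q ∣ Nat.card (normalizer (D : Set G)) → p ≤ q := fun q hq hqY => by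
      by_contra hlt
      have := Fact.mk hq
      refine hpmin q (not_le.1 hlt) ⟨hq, ?_⟩
      obtain ⟨b, hb⟩ := exists_prime_orderOf_dvd_card' q hqY
      have hbY : zpowers (b : G) ≤ normalizer (D : Set G) := by simp
      have hbq : Nat.card (zpowers (b : G)) = q := by rw [Nat.card_zpowers, orderOf_coe, hb]
      obtain ⟨A', hA'D, hA'⟩ := exists_le_card_prime hD
      have hA'p : Nat.card A' = p := by
        obtain ⟨m, hm⟩ := hDp.exists_card_eq
        exact (Nat.prime_dvd_prime_iff_eq hA' hp).1
          (hA'.dvd_of_dvd_pow (hm ▸ card_dvd_of_le hA'D))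
      have h1 := h.eq_of_card_eq hAp (hA.trans hA'p.symm) hr
        ((hss.coverChain_of_le (hA'D.trans hDY)).trans hk)
      have h2 := cardFactors_card_of_le (hA'D.trans hDY)
      have h3 := cardFactors_card_of_le hbY
      rw [ArithmeticFunction.cardFactors_apply_prime hA'] at h2
      rw [hbq, ArithmeticFunction.cardFactors_apply_prime hq] at h3
      refine ⟨_, hbq, ?_⟩
      have h4 := (hss.coverChain_of_le hbY).trans hk
      rwa [show Ω ((zpowers (b : G)).relIndex (normalizer (D : Set G))) + k = r by omega] at h4
    rw [mem_centralizer_iff]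
    intro d hd
    have hox : orderOf (⟨x, hx⟩ : normalizer (D : Set G)) = orderOf x := (orderOf_coe _).symm
    have hcomm := hss.commute_of_coprime hDpY (x := ⟨x, hx⟩) (d := ⟨d, hDY hd⟩)
      (hox ▸ hxp) (Nat.coprime_of_dvd fun q hq hqx hqp => by
        have h1 := hxY q hq (hqx.trans (_root_.orderOf_dvd_natCard _))
        have h2 := Nat.le_of_dvd (Nat.sub_pos_of_lt hp.one_lt) hqp
        have := hp.pos
        omega) (mem_subgroupOf.2 hd)
    exact (congrArg Subtype.val hcomm.eq).symm
  · obtain ⟨N, M, p', n, hs⟩ := ih _ hY hss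
    have hpp' : p' = p := by
      obtain ⟨m, hm⟩ := hDpY.exists_card_eq
      have h1 := hs.le_of_normal _ inferInstance hDY'
      have h2 : p' ∣ p ^ m := hm ▸ (dvd_pow_self p' (by have := hs.two_le; omega)).trans
        (hs.card_eq ▸ card_dvd_of_le h1)
      exact (Nat.prime_dvd_prime_iff_eq hs.prime hp).1 (hs.prime.dvd_of_dvd_pow h2)
    obtain ⟨A', B, a, b, hA', hB, ha, hb, hba⟩ := hs.exists_coverChain
    have h1 := h.eq_of_card_eq hAp (by
      rw [card_map_of_injective (subtype_injective _), hA', hA, hpp'])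
      hr (ha.map_subtype_top.trans hk)
    have h2 := hrmin _ _ (by rwa [card_map_of_injective (subtype_injective _)])
      (hb.map_subtype_top.trans hk)
    omega

end PerfectGroup

section MinimalNormal

open Subgroup

universe u

variable {G : Type u} [Group G]

/-- Averaging: a coprime group of automorphisms of an elementary abelian group `A` that acts on
the quotient of `A` by an invariant hyperplane `N` stabilizes a complement of `N`. -/
theorem exists_notMem_forall_mem_zpowers {A K : Type*} [CommGroup A] [Group K] [Finite K]
    {q : ℕ} [Fact q.Prime] (φ : K →* MulAut A) {N : Subgroup A}
    (hN : ∀ k, ∀ x ∈ N, φ k x ∈ N) (hA : ∀ x : A, x ^ q = 1) {a : A} (ha : a ∉ N)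
    (hcyc : ∀ x : A, ∃ m ∈ N, ∃ j : ℕ, x = m * a ^ j) (hK : (Nat.card K).Coprime q) :
    ∃ b ∉ N, ∀ k, φ k b ∈ zpowers b := by
  classical
  have := Fintype.ofFinite K
  let π := QuotientGroup.mk' N
  have hπ (x : A) (hx : x ∈ N) : π x = 1 := (QuotientGroup.eq_one_iff x).2 hx
  have hπN (x : A) (hx : π x = 1) : x ∈ N := (QuotientGroup.eq_one_iff x).1 hx
  have hq : q.Prime := Fact.out
  have hoa : orderOf (π a) = q :=
    orderOf_eq_prime (by rw [← map_pow, hA, map_one]) fun h => ha (hπN a h)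
  choose m hm c hc using fun k => hcyc (φ k⁻¹ a)
  have hcomp (k : K) (x : A) (j : ℕ) (h : π x = π a ^ j) : π (φ k x) = π (φ k a) ^ j := by
    have h1 : x * (a ^ j)⁻¹ ∈ N := hπN _ (by simp [h])
    have h2 := hπ _ (hN k _ h1)
    rw [map_mul, map_mul, map_inv, map_inv, map_pow, map_pow, mul_inv_eq_one] at h2
    exact h2
  have hπc (k : K) : π (φ k⁻¹ a) = π a ^ c k := by
    rw [hc k, map_mul, hπ _ (hm k), one_mul, map_pow]
  have hπc' (k : K) : π (φ k a) ^ c k = π a := by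
    rw [← hcomp k _ _ (hπc k), ← MulAut.mul_apply, ← map_mul, mul_inv_cancel, map_one,
      MulAut.one_apply]
  have hmod (h k : K) : c (h⁻¹ * k) ≡ c h⁻¹ * c k [MOD q] := by
    rw [← hoa, ← pow_eq_pow_iff_modEq, ← hπc, mul_inv_rev, inv_inv, map_mul, MulAut.mul_apply,
      hcomp k⁻¹ (φ h a) (c h⁻¹) (by simpa using hπc h⁻¹), hπc, ← pow_mul, mul_comm]
  have hpow (x : A) {i j : ℕ} (h : i ≡ j [MOD q]) : x ^ i = x ^ j :=
    pow_eq_pow_iff_modEq.2 (h.of_dvd (orderOf_dvd_of_pow_eq_one (hA x)))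
  refine ⟨∏ k, φ k a ^ c k, fun hb => ?_, fun h => ⟨(c h⁻¹ : ℤ), ?_⟩⟩
  · have h1 := hπ _ hb
    rw [map_prod] at h1
    simp only [map_pow, hπc', Finset.prod_const, Finset.card_univ] at h1
    have h2 := orderOf_dvd_of_pow_eq_one h1
    rw [hoa, ← Nat.card_eq_fintype_card] at h2
    exact (hq.coprime_iff_not_dvd.1 hK.symm) h2
  · change _ ^ (c h⁻¹ : ℤ) = _
    rw [zpow_natCast, map_prod, ← Finset.prod_pow,
      ← Equiv.prod_comp (Equiv.mulLeft h⁻¹) fun k => φ h (φ k a ^ c k)]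
    refine Finset.prod_congr rfl fun k _ => ?_
    rw [Equiv.coe_mulLeft, map_pow, ← MulAut.mul_apply, ← map_mul, mul_inv_cancel_left,
      ← pow_mul, mul_comm]
    exact hpow _ (hmod h k).symm

theorem Subgroup.le_centralizer_of_isSolvable [Finite G] {N : Subgroup G} [N.Normal]
    (hmin : ∀ K : Subgroup G, K.Normal → K ≠ ⊥ → K ≤ N → K = N) (hN : N ≠ ⊥)
    (hs : Group.IsSolvable N) : N ≤ centralizer N := by
  rw [← commutator_eq_bot_iff_le_centralizer]
  by_contra h
  have h1 := hmin ⁅N, N⁆ inferInstance h (commutator_le_right N N)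
  have := (nontrivial_iff_ne_bot N).2 hN
  have h2 := Group.IsSolvable.commutator_lt_top_of_nontrivial N
  have h3 := (map_lt_map_iff_of_injective N.subtype_injective).2 h2
  rw [map_subtype_commutator, h1, ← MonoidHom.range_eq_map, range_subtype] at h3
  exact h3.false

theorem Subgroup.exists_prime_isPGroup_pow_eq_one [Finite G] {N : Subgroup G} [hNn : N.Normal]
    (hmin : ∀ K : Subgroup G, K.Normal → K ≠ ⊥ → K ≤ N → K = N) (hN : N ≠ ⊥)
    (hc : N ≤ centralizer N) : ∃ p, p.Prime ∧ ∀ x ∈ N, x ^ p = 1 := by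
  obtain ⟨H, hHN, hH⟩ := exists_le_card_prime hN
  let K : Subgroup G :=
    { carrier := {x | x ∈ N ∧ x ^ Nat.card H = 1}
      one_mem' := ⟨one_mem _, one_pow _⟩
      mul_mem' := fun {x y} hx hy => ⟨mul_mem hx.1 hy.1, by
        have : Commute x y := (mem_centralizer_iff.1 (hc hy.1)) x hx.1
        rw [this.mul_pow, hx.2, hy.2, one_mul]⟩
      inv_mem' := fun {x} hx => ⟨inv_mem hx.1, by rw [inv_pow, hx.2, inv_one]⟩ }
  have hK : K.Normal := ⟨fun x hx g => ⟨hNn.conj_mem x hx.1 g, by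
    rw [conj_pow, hx.2, mul_one, mul_inv_cancel]⟩⟩
  have hHK : H ≤ K := fun x hx => ⟨hHN hx,
    congrArg Subtype.val (pow_card_eq_one' (x := (⟨x, hx⟩ : H)))⟩
  have hKN := hmin K hK (fun h => ne_bot_of_card_prime hH (le_bot_iff.1 (h ▸ hHK)))
    fun x hx => hx.1
  exact ⟨_, hH, fun x hx => ((hKN ▸ hx : x ∈ K)).2⟩

theorem HasEqualAtomChains.isSolvable_of_minimal [Finite G] (h : HasEqualAtomChains G)
    (ih : ∀ Y : Subgroup G, Y ≠ ⊤ → ¬ IsSupersolvable Y →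
      ∃ (N M : Subgroup Y) (p n : ℕ), MonolithSplitting N M p n)
    {N : Subgroup G} [N.Normal]
    (hmin : ∀ K : Subgroup G, K.Normal → K ≠ ⊥ → K ≤ N → K = N) (hN : N ≠ ⊥) :
    Group.IsSolvable N := by
  rcases eq_or_ne N ⊤ with rfl | htop
  · suffices Group.IsSolvable G from inferInstance
    by_cases hc : _root_.commutator G = ⊥
    · rw [commutator_eq_bot_iff] at hc
      exact Group.isSolvable_of_comm hc.is_comm.comm
    · have h1 := hmin _ inferInstance hc le_top
      have : Nontrivial G := Subgroup.nontrivial_iff.1 ⟨⟨_, _, hN⟩⟩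
      obtain ⟨p, hp, hpd, hC⟩ := h.exists_dvd_centralizesLocally ih
        (fun K hK hKb => hmin K hK hKb le_top) h1
      have := Fact.mk hp
      exact absurd hpd (hC.not_dvd_card h1)
  · by_cases hss : IsSupersolvable N
    · exact hss.isSolvable
    · obtain ⟨_, _, _, _, hs⟩ := ih N htop hss
      exact hs.isSolvable

end MinimalNormal

section Complement

open Subgroup

universe u

variable {G : Type u} [Group G] [Finite G]

theorem Sylow.normal_map_subtype_of_le_sup {q : ℕ} [Fact q.Prime] {L N : Subgroup G} [L.Normal]
    (hfr : ∀ H : Subgroup G, H ⊔ N = ⊤ → H = ⊤) (T : Sylow q L)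
    (hL : L ≤ (T : Subgroup L).map L.subtype ⊔ N) : ((T : Subgroup L).map L.subtype).Normal := by
  rw [← normalizer_eq_top_iff]
  refine hfr _ (top_le_iff.1 ?_)
  rw [← T.normalizer_sup_eq_top]
  exact sup_le le_sup_left (hL.trans (sup_le_sup_right le_normalizer _))

theorem Sylow.normal_of_quotient_isSupersolvable {N : Subgroup G} [N.Normal] {q : ℕ}
    [Fact q.Prime] (hfr : ∀ H : Subgroup G, H ⊔ N = ⊤ → H = ⊤) (hss : IsSupersolvable (G ⧸ N))
    (hq : ∀ r, r.Prime → r ∣ Nat.card G → r ≤ q) (S : Sylow q G) : S.Normal := by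
  let π := QuotientGroup.mk' N
  have hπ : Function.Surjective π := QuotientGroup.mk'_surjective N
  have h1 := hss.sylow_normal (fun r hr hrN => hq r hr (hrN.trans N.card_quotient_dvd_card))
    (S.mapSurjective hπ)
  rw [Sylow.coe_mapSurjective] at h1
  have hL : (((S : Subgroup G).map π).comap π).Normal := h1.comap π
  rw [comap_map_eq, QuotientGroup.ker_mk'] at hL
  have h2 := Sylow.normal_map_subtype_of_le_sup hfr (S.subtype (le_sup_left (b := N)))
    (by rw [Sylow.coe_subtype, subgroupOf_map_subtype, inf_eq_left.2 le_sup_left])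
  rwa [Sylow.coe_subtype, subgroupOf_map_subtype, inf_eq_left.2 le_sup_left] at h2

/-- If no proper subgroup supplements the unique minimal normal subgroup `N` and `G ⧸ N` is
supersolvable, then `N` lies with prime index in a normal subgroup of a normal Sylow subgroup. -/
theorem Sylow.exists_normal_relIndex_eq_prime {N : Subgroup G} [N.Normal] (hN : N ≠ ⊥)
    (hle : ∀ K : Subgroup G, K.Normal → K ≠ ⊥ → N ≤ K)
    (hfr : ∀ H : Subgroup G, H ⊔ N = ⊤ → H = ⊤) (hss : IsSupersolvable (G ⧸ N))
    (hnss : ¬ IsSupersolvable G) :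
    ∃ (q : ℕ) (S : Sylow q G) (L : Subgroup G), q.Prime ∧ S.Normal ∧ L.Normal ∧ N ≤ L ∧
      L ≤ S ∧ N.relIndex L = q := by
  have hG : Nat.card G ≠ 1 := fun h => hnss <| by
    have := (Nat.card_eq_one_iff_unique.1 h).1
    exact isSupersolvable_of_subsingleton
  obtain ⟨q, hq, hqG, hmax⟩ : ∃ q, q.Prime ∧ q ∣ Nat.card G ∧
      ∀ r, r.Prime → r ∣ Nat.card G → r ≤ q := by
    obtain ⟨q, hq, hmax⟩ := (Nat.card G).primeFactors.exists_max_image id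
      (Nat.nonempty_primeFactors.2 (by have := Nat.card_pos (α := G); omega))
    have h0 : Nat.card G ≠ 0 := Nat.card_pos.ne'
    refine ⟨q, Nat.prime_of_mem_primeFactors hq, Nat.dvd_of_mem_primeFactors hq, fun r hr hrG => ?_⟩
    exact hmax r (Nat.mem_primeFactors.2 ⟨hr, hrG, h0⟩)
  have := Fact.mk hq
  obtain ⟨S⟩ : Nonempty (Sylow q G) := inferInstance
  have hSn := S.normal_of_quotient_isSupersolvable hfr hss hmax
  have hNS := hle S hSn (S.ne_bot_of_dvd_card hqG)
  have hNq : IsPGroup q N := S.isPGroup'.to_le hNS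
  have : Nontrivial (G ⧸ N) := by
    rw [QuotientGroup.nontrivial_iff]
    rintro rfl
    exact hnss (hNq.of_equiv topEquiv).isSupersolvable
  obtain ⟨L', hL', hL'p⟩ := hss.exists_normal_card_prime
  let π := QuotientGroup.mk' N
  have hπ : Function.Surjective π := QuotientGroup.mk'_surjective N
  let L := L'.comap π
  have hLn : L.Normal := hL'.comap π
  have hNL : N ≤ L := by
    simpa only [π, QuotientGroup.ker_mk'] using ker_le_comap π L'
  have hrel : N.relIndex L = Nat.card L' := by
    have := relIndex_ker L π
    rwa [QuotientGroup.ker_mk', map_comap_eq_self_of_surjective hπ] at this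
  have hcov : N ⋖ L := covBy_of_relIndex_prime hNL (hrel ▸ hL'p)
  have hcard : Nat.card L = Nat.card N * Nat.card L' := by
    rw [← hrel, card_mul_relIndex_of_le hNL]
  have hqL : Nat.card L' = q := by
    by_contra hne
    have := Fact.mk hL'p
    obtain ⟨T⟩ : Nonempty (Sylow (Nat.card L') L) := inferInstance
    have hTb := T.ne_bot_of_dvd_card (by rw [hcard]; exact dvd_mul_left _ _)
    have hTL : (T : Subgroup L).map L.subtype ≤ L := map_subtype_le _
    have hTb' : (T : Subgroup L).map L.subtype ≠ ⊥ := by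
      rwa [Ne, map_eq_bot_iff_of_injective _ L.subtype_injective]
    have hdisj : N ⊓ (T : Subgroup L).map L.subtype = ⊥ :=
      (IsPGroup.disjoint_of_ne q _ (Ne.symm hne) _ _ hNq (T.isPGroup'.map _)).eq_bot
    have hTN : L ≤ (T : Subgroup L).map L.subtype ⊔ N := by
      rcases hcov.eq_or_eq le_sup_right (sup_le hTL hNL) with h | h
      · refine absurd ?_ hTb'
        rwa [inf_eq_right.2 (le_sup_left.trans h.le)] at hdisj
      · exact h.ge
    have hT := T.normal_map_subtype_of_le_sup hfr hTN
    have h1 := hle _ hT hTb'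
    rw [inf_eq_left.2 h1] at hdisj
    exact hN hdisj
  refine ⟨q, S, L, hq, hSn, hLn, hNL, ?_, hrel.trans hqL⟩
  have hLq : IsPGroup q L := by
    obtain ⟨m, hm⟩ := hNq.exists_card_eq
    exact IsPGroup.of_card (n := m + 1) (by rw [hcard, hm, hqL, pow_succ])
  obtain ⟨S', hS'⟩ := hLq.exists_le_sylow
  have := Sylow.unique_of_normal S hSn
  rwa [Subsingleton.elim S' S] at hS'

end Complement

section Supplement

open Subgroup

open scoped Pointwise

universe u

variable {G : Type u} [Group G]

theorem Subgroup.exists_eq_mul_pow_of_covBy [Finite G] {N L : Subgroup G} [N.Normal] (h : N ⋖ L)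
    {a : G} (ha : a ∈ L) (haN : a ∉ N) {x : G} (hx : x ∈ L) :
    ∃ m ∈ N, ∃ j : ℕ, x = m * a ^ j := by
  have hL : N ⊔ zpowers a = L := by
    rcases h.eq_or_eq le_sup_left (sup_le h.le (zpowers_le.2 ha)) with h' | h'
    · exact absurd (h' ▸ mem_sup_right (mem_zpowers a)) haN
    · exact h'
  rw [← hL, mem_sup_of_normal_left] at hx
  obtain ⟨m, hm, y, hy, rfl⟩ := hx
  obtain ⟨j, rfl⟩ := mem_powers_iff_mem_zpowers.2 hy
  exact ⟨m, hm, j, rfl⟩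

theorem Subgroup.le_centralizer_of_covBy [Finite G] {N L : Subgroup G} [N.Normal] (h : N ⋖ L)
    (hc : N ≤ centralizer L) : L ≤ centralizer L := by
  obtain ⟨a, ha, haN⟩ := SetLike.exists_of_lt h.lt
  have hN {m x : G} (hm : m ∈ N) (hx : x ∈ L) : Commute x m := (mem_centralizer_iff.1 (hc hm)) x hx
  have haL : a ∈ centralizer (L : Set G) := mem_centralizer_iff.2 fun x hx => by
    obtain ⟨m, hm, j, rfl⟩ := exists_eq_mul_pow_of_covBy h ha haN hx
    exact ((hN hm ha).symm.mul_left (Commute.pow_self a j)).eq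
  intro x hx
  obtain ⟨m, hm, j, rfl⟩ := exists_eq_mul_pow_of_covBy h ha haN hx
  exact mul_mem (hc hm) (pow_mem haL j)

theorem Subgroup.pow_eq_one_of_relIndex_eq [Finite G] {N L : Subgroup G} [N.Normal]
    [hL : L.Normal] {q : ℕ} (hle : ∀ K : Subgroup G, K.Normal → K ≠ ⊥ → N ≤ K)
    (hN : ∀ x ∈ N, x ^ q = 1) (hcard : ¬ Nat.card N ∣ q) (hcov : N ⋖ L) (hq : N.relIndex L = q)
    (hc : L ≤ centralizer L) {a : G} (ha : a ∈ L) : a ^ q = 1 := by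
  by_cases haN : a ∈ N
  · exact hN a haN
  by_contra hne
  have haq : a ^ q ∈ N := hq ▸ N.pow_relIndex_mem ha
  have hnorm : (zpowers (a ^ q)).Normal := by
    rw [← normalizer_eq_top_iff, ← top_le_iff, le_normalizer_iff]
    rintro g - _ ⟨i, rfl⟩
    obtain ⟨m, hm, j, hj⟩ := exists_eq_mul_pow_of_covBy hcov ha haN (hL.conj_mem a ha g)
    have hcomm : Commute m (a ^ j) := (mem_centralizer_iff.1 (hc (pow_mem ha j))) m (hcov.le hm)
    have h1 : g * a ^ q * g⁻¹ = (a ^ q) ^ j := by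
      rw [← conj_pow, hj, hcomm.mul_pow, hN m hm, one_mul, ← pow_mul, ← pow_mul, mul_comm]
    change g * (a ^ q) ^ i * g⁻¹ ∈ _
    rw [← conj_zpow, h1]
    exact zpow_mem (pow_mem (mem_zpowers _) _) _
  have h1 := hle _ hnorm (by rwa [Ne, zpowers_eq_bot])
  have h2 : N = zpowers (a ^ q) := h1.antisymm (zpowers_le.2 haq)
  rw [h2, Nat.card_zpowers] at hcard
  exact hcard (orderOf_dvd_of_pow_eq_one (hN _ haq))

theorem Subgroup.exists_le_normalizer_zpowers [Finite G] {N L K : Subgroup G} [hNn : N.Normal]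
    [L.Normal] {q : ℕ} [Fact q.Prime] (hcov : N ⋖ L) (hc : L ≤ centralizer L)
    (hL : ∀ x ∈ L, x ^ q = 1) (hK : (Nat.card K).Coprime q) :
    ∃ b ∈ L, b ∉ N ∧ K ≤ normalizer (zpowers b : Subgroup G) := by
  let : CommGroup L :=
    { (inferInstance : Group L) with
      mul_comm := fun x y => Subtype.ext (mem_centralizer_iff.1 (hc y.2) x x.2) }
  obtain ⟨a, ha, haN⟩ := SetLike.exists_of_lt hcov.lt
  obtain ⟨b, hbN, hb⟩ := exists_notMem_forall_mem_zpowers (q := q)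
    ((MulAut.conjNormal (H := L)).comp K.subtype) (N := N.subgroupOf L) (a := ⟨a, ha⟩)
    (fun k x hx => mem_subgroupOf.2 (by
      simpa using hNn.conj_mem _ (mem_subgroupOf.1 hx) k))
    (fun x => Subtype.ext (hL x x.2)) (fun h => haN (mem_subgroupOf.1 h))
    (fun x => by
      obtain ⟨m, hm, j, hj⟩ := exists_eq_mul_pow_of_covBy hcov ha haN x.2
      exact ⟨⟨m, hcov.le hm⟩, mem_subgroupOf.2 hm, j, Subtype.ext hj⟩) hK
  refine ⟨b, b.2, fun h => hbN (mem_subgroupOf.2 h), le_normalizer_iff.2 ?_⟩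
  rintro k hk _ ⟨i, rfl⟩
  obtain ⟨j, hj⟩ := hb ⟨k, hk⟩
  have hj' : k * b * k⁻¹ = (b : G) ^ j := by
    have := congrArg Subtype.val hj
    simpa using this.symm
  change k * (b : G) ^ i * k⁻¹ ∈ _
  rw [← conj_zpow, hj']
  exact zpow_mem (zpow_mem (mem_zpowers _) _) _

theorem Subgroup.normal_inf_of_le_centralizer {N S K X : Subgroup G} [N.Normal]
    (hSK : S ⊔ K = ⊤) (hS : S ≤ centralizer N) (hKX : K ≤ X) : (N ⊓ X).Normal := by
  rw [← normalizer_eq_top_iff, ← top_le_iff, ← hSK, sup_le_iff]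
  refine ⟨hS.trans ((centralizer_le (Set.inter_subset_left)).trans (centralizer_le_normalizer _)),
    hKX.trans ?_⟩
  exact le_trans (le_inf le_normalizer_of_normal le_normalizer) inf_normalizer_le_normalizer_inf

theorem HasEqualAtomChains.exists_isCoatom_not_le [Finite G] (h : HasEqualAtomChains G)
    {N : Subgroup G} [N.Normal] (hN : N ≠ ⊥)
    (hle : ∀ K : Subgroup G, K.Normal → K ≠ ⊥ → N ≤ K)
    (hc : N ≤ centralizer N) (hss : IsSupersolvable (G ⧸ N)) (hnss : ¬ IsSupersolvable G) :
    ∃ M : Subgroup G, IsCoatom M ∧ ¬ N ≤ M := by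
  by_contra! hcontra
  have hfr (H : Subgroup G) (hH : H ⊔ N = ⊤) : H = ⊤ := by
    by_contra hne
    obtain ⟨M, hM, hHM⟩ := (eq_top_or_exists_le_coatom H).resolve_left hne
    exact hM.1 (top_le_iff.1 (hH ▸ sup_le hHM (hcontra M hM)))
  have hmin (K : Subgroup G) (hK : K.Normal) (hKb : K ≠ ⊥) (hKN : K ≤ N) : K = N :=
    hKN.antisymm (hle K hK hKb)
  obtain ⟨q, S, L, hq, hSn, hLn, hNL, hLS, hrel⟩ :=
    Sylow.exists_normal_relIndex_eq_prime hN hle hfr hss hnss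
  have := Fact.mk hq
  have hNp : ¬ (Nat.card N).Prime := fun hp => hnss (.of_quotient_card_prime hp hss)
  have hN1 : Nat.card N ≠ 1 := by rwa [Ne, card_eq_one]
  have hcov : N ⋖ L := covBy_of_relIndex_prime hNL (hrel ▸ hq)
  have hexpN : ∀ x ∈ N, x ^ q = 1 := by
    obtain ⟨p, hp, hpN⟩ := exists_prime_isPGroup_pow_eq_one hmin hN hc
    have := Fact.mk hp
    have hN2 : IsPGroup p N := fun x => ⟨1, by
      rw [pow_one]
      exact Subtype.ext (hpN x x.2)⟩
    rcases eq_or_ne p q with rfl | hne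
    · exact hpN
    · have := IsPGroup.disjoint_of_ne p q hne N N hN2 (S.isPGroup'.to_le (hNL.trans hLS))
      exact absurd (disjoint_self.1 this) hN
  have hNS : N ≤ centralizer (S : Set G) :=
    le_centralizer_of_isNilpotent (Q := S) S.isPGroup'.isNilpotent hmin (hNL.trans hLS)
  have hLc := le_centralizer_of_covBy hcov (hNS.trans (centralizer_le hLS))
  have hexpL (x : G) (hx : x ∈ L) : x ^ q = 1 :=
    pow_eq_one_of_relIndex_eq hle hexpN (fun hd => hNp (by
      rwa [((Nat.dvd_prime hq).1 hd).resolve_left hN1])) hcov hrel hLc hx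
  obtain ⟨K, hK⟩ := exists_right_complement'_of_coprime (N := (S : Subgroup G)) S.card_coprime_index
  have hKq : (Nat.card K).Coprime q := by
    rw [← hK.symm.index_eq_card]
    exact ((hq.coprime_iff_not_dvd).2 S.not_dvd_index).symm
  obtain ⟨b, hbL, hbN, hKb⟩ := exists_le_normalizer_zpowers hcov hLc hexpL hKq
  have hb1 : b ≠ 1 := fun hb => hbN (hb ▸ one_mem N)
  have hAcard : Nat.card (zpowers b) = q := by
    rw [Nat.card_zpowers, orderOf_eq_prime (hexpL b hbL) hb1]
  have hAL : zpowers b ≤ L := zpowers_le.2 hbL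
  have hSN : (S : Subgroup G) ≤ centralizer N := le_centralizer_iff.1 hNS
  have hsplit (Z : Subgroup G) (hZ : K ≤ Z) : N ⊓ Z = ⊥ ∨ N ≤ Z := by
    by_cases hb : N ⊓ Z = ⊥
    · exact .inl hb
    · exact .inr ((hle _ (normal_inf_of_le_centralizer hK.sup_eq_top hSN hZ) hb).trans inf_le_right)
  set A := zpowers b
  have hbot : N ⊓ (A ⊔ K) = ⊥ := by
    refine (hsplit _ le_sup_right).resolve_right fun hNX => ?_
    have hNA : N ≤ A := fun n hn => by
      have h1 : n ∈ ((A ⊔ K : Subgroup G) : Set G) := hNX hn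
      rw [coe_mul_of_right_le_normalizer_left _ _ hKb] at h1
      obtain ⟨a, ha, k, hk, rfl⟩ := h1
      have h2 : k ∈ (S : Subgroup G) :=
        hLS ((mul_mem_cancel_left (hAL ha)).1 (hNL hn))
      have h3 : k = 1 := mem_bot.1 (hK.disjoint.eq_bot ▸ ⟨h2, hk⟩ : k ∈ (⊥ : Subgroup G))
      change a * k ∈ A
      rwa [h3, mul_one]
    have hd := card_dvd_of_le hNA
    rw [hAcard] at hd
    exact hNp (by rwa [((Nat.dvd_prime hq).1 hd).resolve_left hN1])
  have hcov' : A ⊔ K ⋖ N ⊔ (A ⊔ K) := by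
    refine ⟨lt_of_le_of_ne le_sup_right fun heq => ?_, fun Z hXZ hZ => ?_⟩
    · have : N ≤ A ⊔ K := heq ▸ le_sup_left
      exact hN (by rwa [inf_eq_left.2 this] at hbot)
    · rcases hsplit Z (le_sup_right.trans hXZ.le) with hb | hb
      · refine hXZ.not_ge fun z hz => ?_
        obtain ⟨n, hn, x, hx, rfl⟩ := mem_sup_of_normal_left.1 (hZ.le hz)
        have : n ∈ N ⊓ Z := ⟨hn, by simpa using mul_mem hz (inv_mem (hXZ.le hx))⟩
        rw [hb, mem_bot] at this
        rwa [this, one_mul]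
      · exact hZ.not_ge (sup_le hb hXZ.le)
  have hrelN : (A ⊔ K).relIndex (N ⊔ (A ⊔ K)) = Nat.card N := by
    have h1 : N.relIndex (A ⊔ K) = Nat.card (A ⊔ K : Subgroup G) := by
      rw [← inf_relIndex_right, hbot, relIndex_bot_left]
    have h2 := card_mul_relIndex_of_le (le_sup_right : A ⊔ K ≤ N ⊔ (A ⊔ K))
    rw [← card_mul_relIndex_of_le (le_sup_left : N ≤ N ⊔ (A ⊔ K)), relIndex_sup_left, h1,
      mul_comm] at h2
    exact Nat.eq_of_mul_eq_mul_right Nat.card_pos h2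
  obtain ⟨i, hi, hi'⟩ := exists_coverChain_le A (A ⊔ K) le_sup_left
  obtain ⟨j, hj, hj'⟩ := exists_coverChain_le (N ⊔ (A ⊔ K)) ⊤ le_top
  have h1 := h A _ _ (hAcard ▸ hq)
    (((S.isPGroup'.to_le hLS).coverChain_of_le hAL).trans
      (hss.coverChain_of_quotient hNL)) (hi'.trans (.cons hcov' hj'))
  have h2 : Ω (A.relIndex L) + Ω L.index = Ω A.index := by
    rw [← relIndex_mul_index hAL, ArithmeticFunction.cardFactors_mul
      (relIndex_ne_zero_of_finite _ _) index_ne_zero_of_finite]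
  have h3 : Ω (A.relIndex (A ⊔ K)) + Ω (Nat.card N) + Ω ((N ⊔ (A ⊔ K)).relIndex ⊤) = Ω A.index := by
    rw [← hrelN, relIndex_top_right, ← relIndex_mul_index (le_sup_left : A ≤ A ⊔ K),
      ← relIndex_mul_index (le_sup_right : A ⊔ K ≤ N ⊔ (A ⊔ K)),
      ArithmeticFunction.cardFactors_mul (relIndex_ne_zero_of_finite _ _)
        (mul_ne_zero (relIndex_ne_zero_of_finite _ _) index_ne_zero_of_finite),
      ArithmeticFunction.cardFactors_mul (relIndex_ne_zero_of_finite _ _)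
        index_ne_zero_of_finite, add_assoc]
  have h4 : 2 ≤ Ω (Nat.card N) := by
    have h0 : Ω (Nat.card N) ≠ 0 := by
      simp [ArithmeticFunction.cardFactors_eq_zero_iff_eq_zero_or_one, hN, Nat.card_pos.ne']
    have h1 := mt ArithmeticFunction.cardFactors_eq_one_iff_prime.1 hNp
    omega
  omega

end Supplement

section Classification

open Subgroup

universe u

/-- Every non-supersolvable finite group with equal atom chains is a faithful split extension of
its unique minimal normal subgroup by a supersolvable maximal subgroup. -/
theorem HasEqualAtomChains.exists_monolithSplitting {G : Type u} [Group G] [Finite G]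
    (h : HasEqualAtomChains G) (hnss : ¬ IsSupersolvable G) :
    ∃ (N M : Subgroup G) (p n : ℕ), MonolithSplitting N M p n := by
  induction hcard : Nat.card G using Nat.strong_induction_on generalizing G with
  | h m ih =>
  subst hcard
  have : Nontrivial G := not_subsingleton_iff_nontrivial.1 fun _ =>
    hnss isSupersolvable_of_subsingleton
  have ihY (Y : Subgroup G) (hY : Y ≠ ⊤) (hYs : ¬ IsSupersolvable Y) :
      ∃ (N M : Subgroup Y) (p n : ℕ), MonolithSplitting N M p n :=
    ih _ (card_lt_of_ne_top hY) (h.subgroup Y) hYs rfl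
  have hquot (K : Subgroup G) [K.Normal] (hK : K ≠ ⊥) : IsSupersolvable (G ⧸ K) := by
    by_contra hs
    obtain ⟨N, M, p, n, hNM⟩ := ih _ (card_quotient_lt hK) (h.quotient K hK) hs rfl
    obtain ⟨A, B, a, b, hA, hB, ha, hb, hlt⟩ := hNM.exists_coverChain
    have := h.quotient_bot K hK (.cons (bot_covBy_of_card_prime (hA ▸ hNM.prime)) ha)
      (.cons (bot_covBy_of_card_prime hB) hb)
    omega
  obtain ⟨N, ⟨hNn, hN⟩, hNmin⟩ := wellFounded_lt.has_min {K : Subgroup G | K.Normal ∧ K ≠ ⊥}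
    ⟨⊤, inferInstance, bot_lt_top.ne'⟩
  have hmin (K : Subgroup G) (hK : K.Normal) (hKb : K ≠ ⊥) (hKN : K ≤ N) : K = N :=
    hKN.eq_of_not_lt (hNmin K ⟨hK, hKb⟩)
  have hle (K : Subgroup G) (hK : K.Normal) (hKb : K ≠ ⊥) : N ≤ K := by
    by_contra hNK
    have h1 : N ⊓ K = ⊥ := by
      by_contra hb
      exact hNK ((hmin _ inferInstance hb inf_le_left).ge.trans inf_le_right)
    exact hnss (.of_inf_eq_bot h1 (hquot N hN) (hquot K hKb))
  have hc := le_centralizer_of_isSolvable hmin hN (h.isSolvable_of_minimal ihY hmin hN)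
  obtain ⟨p, hp, hpN⟩ := exists_prime_isPGroup_pow_eq_one hmin hN hc
  have := Fact.mk hp
  have hNp : IsPGroup p N := fun x => ⟨1, by
    rw [pow_one]
    exact Subtype.ext (hpN x x.2)⟩
  obtain ⟨n, hn⟩ := hNp.exists_card_eq
  have hn2 : 2 ≤ n := by
    match n, hn with
    | 0, hn => exact absurd (card_eq_one.1 (hn.trans (pow_zero p))) hN
    | 1, hn => exact absurd (.of_quotient_card_prime (by rwa [hn, pow_one]) (hquot N hN)) hnss
    | n + 2, _ => omega
  obtain ⟨M, hM, hNM⟩ := h.exists_isCoatom_not_le hN hle hc (hquot N hN) hnss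
  have hsup : N ⊔ M = ⊤ := hM.2 _ (lt_of_le_of_ne le_sup_right fun h' => hNM (h' ▸ le_sup_left))
  have hinf : N ⊓ M = ⊥ := by
    by_contra hb
    exact hNM ((hle _ (normal_inf_of_le_centralizer hsup hc le_rfl) hb).trans inf_le_right)
  refine ⟨N, M, p, n, hNn, hN, hle, hp, hn2, hn, ?_, hM,
    (hquot N hN).of_quotient_complement hsup hinf, hinf, hsup⟩
  refine le_antisymm (fun x hx => ?_) hc
  have hCM : centralizer (N : Set G) ⊓ M = ⊥ := by
    by_contra hb
    refine hNM ((hle _ ?_ hb).trans inf_le_right)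
    exact normal_inf_of_le_centralizer hsup (le_centralizer_iff.1 le_rfl) le_rfl
  obtain ⟨y, hy, z, hz, rfl⟩ := mem_sup_of_normal_left.1 (hsup ▸ mem_top x)
  have hz' : z ∈ centralizer (N : Set G) ⊓ M := ⟨(mul_mem_cancel_left (hc hy)).1 hx, hz⟩
  rw [hCM, mem_bot] at hz'
  rwa [hz', mul_one]

theorem MonolithSplitting.frattini_eq_bot {G : Type u} [Group G] {N M : Subgroup G} {p n : ℕ}
    (h : MonolithSplitting N M p n) : frattini G = ⊥ := by
  by_contra hb
  have h1 := (h.le_of_normal _ inferInstance hb).trans (frattini_le_coatom h.isCoatom)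
  exact h.ne_bot (by rw [← h.inf_eq_bot, inf_eq_left.2 h1])

theorem MonolithSplitting.center_eq_bot {G : Type u} [Group G] [Finite G] {N M : Subgroup G}
    {p n : ℕ} (h : MonolithSplitting N M p n) : center G = ⊥ := by
  by_contra hb
  have h1 := h.le_of_normal _ inferInstance hb
  have h2 : N = ⊤ := by
    rw [← h.centralizer_eq, centralizer_eq_top_iff_subset]
    exact h1
  have h3 := h.inf_eq_bot
  rw [h2, top_inf_eq] at h3
  obtain ⟨A, hAN, hA⟩ := exists_le_card_prime h.ne_bot
  have hAtop : A = ⊤ := h.isCoatom.2 A (h3 ▸ bot_lt_iff_ne_bot.2 (ne_bot_of_card_prime hA))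
  rw [hAtop, ← h2, h.card_eq] at hA
  exact Nat.Prime.not_prime_pow h.two_le hA

theorem MonolithSplitting.eq_fitting {G : Type u} [Group G] [Finite G] {N M F : Subgroup G}
    {p n : ℕ} (h : MonolithSplitting N M p n) [F.Normal] (hF : Group.IsNilpotent F)
    (hFmax : ∀ K : Subgroup G, K.Normal → Group.IsNilpotent K → K ≤ F) : N = F := by
  have := h.normal
  have := Fact.mk h.prime
  have hNF := hFmax N h.normal (IsPGroup.of_card h.card_eq).isNilpotent
  refine hNF.antisymm ?_
  rw [← h.centralizer_eq, ← le_centralizer_iff]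
  exact le_centralizer_of_isNilpotent hF
    (fun K hK hKb hKN => hKN.antisymm (h.le_of_normal K hK hKb)) hNF

end Classification

theorem stmt_7 {G : Type*} [Group G] [Finite G]
    (hchains : ∀ H : Subgroup G, (Nat.card H).Prime → AllMaxChainsSameLength H)
    (F : Subgroup G) (hFnormal : F.Normal) (hFnilpotent : Group.IsNilpotent F)
    (hFmax : ∀ N : Subgroup G, N.Normal → Group.IsNilpotent N → N ≤ F) :
    ¬ IsSupersolvable G ↔
      (frattini G = ⊥ ∧ Subgroup.center G = ⊥ ∧
        (F ≠ ⊥ ∧ ∀ N : Subgroup G, N.Normal → N ≠ ⊥ → F ≤ N) ∧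
        (∃ p n : ℕ, p.Prime ∧ 2 ≤ n ∧ Nat.card F = p ^ n) ∧
        (∃ M : Subgroup G, IsCoatom M ∧ IsSupersolvable M ∧
          F ⊓ M = ⊥ ∧ F ⊔ M = ⊤) ∧
        Subgroup.centralizer (F : Set G) = F) := by
  constructor
  · intro hnss
    obtain ⟨N, M, p, n, h⟩ := (HasEqualAtomChains.of_forall hchains).exists_monolithSplitting hnss
    obtain rfl := h.eq_fitting hFnilpotent hFmax
    exact ⟨h.frattini_eq_bot, h.center_eq_bot, ⟨h.ne_bot, h.le_of_normal⟩,
      ⟨p, n, h.prime, h.two_le, h.card_eq⟩,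
      ⟨M, h.isCoatom, h.isSupersolvable, h.inf_eq_bot, h.sup_eq_top⟩, h.centralizer_eq⟩
  · rintro ⟨-, -, ⟨hF, hle⟩, ⟨p, n, hp, hn, hcard⟩, -, -⟩ hss
    have : Nontrivial G := Subgroup.nontrivial_iff.1 ⟨⟨_, _, hF⟩⟩
    obtain ⟨A, hA, hAp⟩ := hss.exists_normal_card_prime
    have hd := Subgroup.card_dvd_of_le (hle A hA (Subgroup.ne_bot_of_card_prime hAp))
    rw [hcard] at hd
    have h1 : p ^ n ≠ 1 := (Nat.one_lt_pow (by omega) hp.one_lt).ne'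
    exact Nat.Prime.not_prime_pow hn (((Nat.dvd_prime hAp).1 hd).resolve_left h1 ▸ hAp)
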